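/- arXiv:1302.4802 — 7 statements merged into one kernel-verified Lean document; each statement's English description precedes it below -/
import Mathlib

section
/- Let ψ : M₂(ℂ) → ℂ⁴ be the ℂ-linear map ψ(M) = (u₁₂+u₂₁, i(u₁₂−u₂₁), −(u₁₁−u₂₂), −i(u₁₁+u₂₂)) for M = (u_{jk}), and let φ : sl₂(ℂ) → ℂ³ be the map φ(X) = (−i(x₁₂+x₂₁), x₁₂−x₂₁, 2i·x₁₁). Then ψ is a linear bijection, and for every traceless X ∈ M₂(ℂ) with φ(X) = (a₁,a₂,a₃) and every M ∈ M₂(ℂ) (viewing ψ(M) as a column vector): ψ(X·M) = Σ_{i=1}^{3} a_i · (α^{+i})ᵀ · ψ(M) and ψ(M·X) = −Σ_{i=1}^{3} a_i · (α^{−i})ᵀ · ψ(M). -/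
open Matrix

noncomputable section

/-- The totally antisymmetric symbol on `{1,2,3}` (as `Fin 3`), with `ε_{123} = 1`. -/
def eps3 (i j k : Fin 3) : ℂ :=
  if (i, j, k) = (0, 1, 2) ∨ (i, j, k) = (1, 2, 0) ∨ (i, j, k) = (2, 0, 1) then 1
  else if (i, j, k) = (2, 1, 0) ∨ (i, j, k) = (1, 0, 2) ∨ (i, j, k) = (0, 2, 1) then -1
  else 0

/-- The antisymmetric symbol with indices in `{1,2,3,4}` (as `Fin 4`), set to `0`
if any index equals `4`. -/
def eps4 (i : Fin 3) (p q : Fin 4) : ℂ :=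
  if hp : (p : ℕ) < 3 then
    if hq : (q : ℕ) < 3 then eps3 i ⟨p, hp⟩ ⟨q, hq⟩ else 0
  else 0

/-- The matrices `α^{+i}` with `α^{+i}_{pq} = (1/2)(δ_{ip}δ_{4q} − δ_{iq}δ_{4p}) + (1/2)ε_{ipq}`. -/
def alphaP (i : Fin 3) : Matrix (Fin 4) (Fin 4) ℂ :=
  Matrix.of fun p q =>
    (1 / 2) * ((if (p : ℕ) = (i : ℕ) then 1 else 0) * (if q = 3 then 1 else 0)
      - (if (q : ℕ) = (i : ℕ) then 1 else 0) * (if p = 3 then 1 else 0))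
    + (1 / 2) * eps4 i p q

/-- The matrices `α^{−i}` with `α^{−i}_{pq} = −(1/2)(δ_{ip}δ_{4q} − δ_{iq}δ_{4p}) + (1/2)ε_{ipq}`. -/
def alphaM (i : Fin 3) : Matrix (Fin 4) (Fin 4) ℂ :=
  Matrix.of fun p q =>
    -(1 / 2) * ((if (p : ℕ) = (i : ℕ) then 1 else 0) * (if q = 3 then 1 else 0)
      - (if (q : ℕ) = (i : ℕ) then 1 else 0) * (if p = 3 then 1 else 0))
    + (1 / 2) * eps4 i p q

/-- `ψ(M) = (u₁₂+u₂₁, i(u₁₂−u₂₁), −(u₁₁−u₂₂), −i(u₁₁+u₂₂))`. -/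
def psiMap (M : Matrix (Fin 2) (Fin 2) ℂ) : Fin 4 → ℂ :=
  ![M 0 1 + M 1 0, Complex.I * (M 0 1 - M 1 0),
    -(M 0 0 - M 1 1), -Complex.I * (M 0 0 + M 1 1)]

/-- `φ(X) = (−i(x₁₂+x₂₁), x₁₂−x₂₁, 2i·x₁₁)`. -/
def phiMap (X : Matrix (Fin 2) (Fin 2) ℂ) : Fin 3 → ℂ :=
  ![-Complex.I * (X 0 1 + X 1 0), X 0 1 - X 1 0, 2 * Complex.I * X 0 0]

lemma alphaP_eq : alphaP = ![
    !![0, 0, 0, 1/2; 0, 0, 1/2, 0; 0, -1/2, 0, 0; -1/2, 0, 0, 0],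
    !![0, 0, -1/2, 0; 0, 0, 0, 1/2; 1/2, 0, 0, 0; 0, -1/2, 0, 0],
    !![0, 1/2, 0, 0; -1/2, 0, 0, 0; 0, 0, 0, 1/2; 0, 0, -1/2, 0]] := by
  ext i p q
  fin_cases i <;> fin_cases p <;> fin_cases q <;> simp [alphaP, eps4, eps3] <;> norm_num

lemma alphaM_eq : alphaM = ![
    !![0, 0, 0, -1/2; 0, 0, 1/2, 0; 0, -1/2, 0, 0; 1/2, 0, 0, 0],
    !![0, 0, -1/2, 0; 0, 0, 0, -1/2; 1/2, 0, 0, 0; 0, 1/2, 0, 0],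
    !![0, 1/2, 0, 0; -1/2, 0, 0, 0; 0, 0, 0, -1/2; 0, 0, 1/2, 0]] := by
  ext i p q
  fin_cases i <;> fin_cases p <;> fin_cases q <;> simp [alphaM, eps4, eps3] <;> norm_num

/-- The inverse of `ψ`. -/
def psiInv (v : Fin 4 → ℂ) : Matrix (Fin 2) (Fin 2) ℂ :=
  !![(Complex.I * v 3 - v 2) / 2, (v 0 - Complex.I * v 1) / 2;
    (v 0 + Complex.I * v 1) / 2, (Complex.I * v 3 + v 2) / 2]

lemma psiInv_leftInverse : Function.LeftInverse psiInv psiMap := by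
  intro M
  ext j k
  fin_cases j <;> fin_cases k <;> simp [psiInv, psiMap] <;> grind [Complex.I_mul_I]

lemma psiInv_rightInverse : Function.RightInverse psiInv psiMap := by
  intro v
  ext p
  fin_cases p <;> simp [psiInv, psiMap] <;> grind [Complex.I_mul_I]

lemma psiMap_mul_left (X M : Matrix (Fin 2) (Fin 2) ℂ) (hX : X.trace = 0) :
    psiMap (X * M) = ∑ i : Fin 3, phiMap X i • (alphaP i)ᵀ.mulVec (psiMap M) := by
  have h : X 1 1 = -X 0 0 := by rw [trace_fin_two] at hX; linear_combination hX
  ext p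
  fin_cases p <;>
    simp [alphaP_eq, psiMap, phiMap, Fin.sum_univ_succ, Matrix.mul_apply, mulVec, dotProduct, h] <;>
    grind [Complex.I_mul_I]

lemma psiMap_mul_right (X M : Matrix (Fin 2) (Fin 2) ℂ) (hX : X.trace = 0) :
    psiMap (M * X) = -∑ i : Fin 3, phiMap X i • (alphaM i)ᵀ.mulVec (psiMap M) := by
  have h : X 1 1 = -X 0 0 := by rw [trace_fin_two] at hX; linear_combination hX
  ext p
  fin_cases p <;>
    simp [alphaM_eq, psiMap, phiMap, Fin.sum_univ_succ, Matrix.mul_apply, mulVec, dotProduct, h] <;>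
    grind [Complex.I_mul_I]

/-- `ψ` is a linear bijection and intertwines left/right multiplication by traceless
matrices with the action of the transposed matrices `α^{±i}` weighted by `φ(X)`. -/
theorem psi_intertwines_alpha :
    (∀ M N : Matrix (Fin 2) (Fin 2) ℂ, psiMap (M + N) = psiMap M + psiMap N) ∧
    (∀ (c : ℂ) (M : Matrix (Fin 2) (Fin 2) ℂ), psiMap (c • M) = c • psiMap M) ∧
    Function.Bijective psiMap ∧
    (∀ X M : Matrix (Fin 2) (Fin 2) ℂ, X.trace = 0 →
      psiMap (X * M) = ∑ i : Fin 3, phiMap X i • (alphaP i)ᵀ.mulVec (psiMap M)) ∧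
    (∀ X M : Matrix (Fin 2) (Fin 2) ℂ, X.trace = 0 →
      psiMap (M * X) = -∑ i : Fin 3, phiMap X i • (alphaM i)ᵀ.mulVec (psiMap M)) := by
  refine ⟨fun M N => ?_, fun c M => ?_,
    ⟨psiInv_leftInverse.injective, psiInv_rightInverse.surjective⟩,
    psiMap_mul_left, psiMap_mul_right⟩
  · ext p
    fin_cases p <;> simp [psiMap] <;> ring
  · ext p
    fin_cases p <;> simp [psiMap] <;> ring

end
end

section
/- For every γ ∈ ℂ, the bracket table of the large N=4 superconformal algebra g(γ) defines a Lie superalgebra. Precisely: on the ℤ/2-graded complex vector space with even basis {c} ∪ {L_m, U_m, T^{+i}_m, T^{−i}_m : m ∈ ℤ, i = 1,2,3} and odd basis {G^p_s, Q^p_s : s ∈ ℤ+1/2, p = 1,…,4}, the unique bilinear bracket determined by the listed relations (with c central) satisfies super skew-symmetry and the super Jacobi identity. -/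
noncomputable section

namespace LargeN4Gamma

/-- The totally antisymmetric symbol on `Fin 3` with `ε_{123} = 1`. -/
def eps3 (i j k : Fin 3) : ℂ :=
  if (i, j, k) = (0, 1, 2) ∨ (i, j, k) = (1, 2, 0) ∨ (i, j, k) = (2, 0, 1) then 1
  else if (i, j, k) = (2, 1, 0) ∨ (i, j, k) = (1, 0, 2) ∨ (i, j, k) = (0, 2, 1) then -1
  else 0

/-- The antisymmetric symbol with indices in `Fin 4`, `0` if any index is `4` (i.e. `3`). -/
def eps4 (i : Fin 3) (p q : Fin 4) : ℂ :=
  if hp : (p : ℕ) < 3 then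
    if hq : (q : ℕ) < 3 then eps3 i ⟨p, hp⟩ ⟨q, hq⟩ else 0
  else 0

/-- `α^{+i}_{pq} = (1/2)(δ_{ip}δ_{4q} − δ_{iq}δ_{4p}) + (1/2)ε_{ipq}`. -/
def alP (i : Fin 3) (p q : Fin 4) : ℂ :=
  (1 / 2) * ((if (p : ℕ) = (i : ℕ) then 1 else 0) * (if q = 3 then 1 else 0)
    - (if (q : ℕ) = (i : ℕ) then 1 else 0) * (if p = 3 then 1 else 0))
  + (1 / 2) * eps4 i p q

/-- `α^{−i}_{pq} = −(1/2)(δ_{ip}δ_{4q} − δ_{iq}δ_{4p}) + (1/2)ε_{ipq}`. -/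
def alM (i : Fin 3) (p q : Fin 4) : ℂ :=
  -(1 / 2) * ((if (p : ℕ) = (i : ℕ) then 1 else 0) * (if q = 3 then 1 else 0)
    - (if (q : ℕ) = (i : ℕ) then 1 else 0) * (if p = 3 then 1 else 0))
  + (1 / 2) * eps4 i p q

/-- Basis of `g(γ)`: the central element `c`; even generators `L_m, U_m, T^{±i}_m` (`m ∈ ℤ`);
odd generators `G^p_s, Q^p_s` with `s ∈ ℤ + 1/2` encoded as `G p k ↦ G^p_{k+1/2}`,
`Q p k ↦ Q^p_{k+1/2}`. -/
inductive Gen : Type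
  | C : Gen
  | L : ℤ → Gen
  | U : ℤ → Gen
  | Tp : Fin 3 → ℤ → Gen
  | Tm : Fin 3 → ℤ → Gen
  | G : Fin 4 → ℤ → Gen
  | Q : Fin 4 → ℤ → Gen

/-- The underlying vector space of `g(γ)`: formal ℂ-linear combinations of generators. -/
abbrev V := Gen →₀ ℂ

/-- A scalar multiple of a single basis vector. -/
def sgl (a : Gen) (c : ℂ) : V := Finsupp.single a c

/-- Kronecker delta. -/
def kdel {n : ℕ} (i j : Fin n) : ℂ := if i = j then 1 else 0

/-- The bracket of `g(γ)` on basis elements, following the table of Section 2 of the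
paper (the reversed-order brackets are the ones forced by super skew-symmetry). -/
def br (γ : ℂ) : Gen → Gen → V
  | .C, _ => 0
  | _, .C => 0
  | .L m, .L n => sgl (.L (m + n)) ((m : ℂ) - n)
      + sgl .C (if n = -m then ((m : ℂ) ^ 3 - m) / 12 else 0)
  | .L m, .U n => sgl (.U (m + n)) (-(n : ℂ))
      + sgl .C (if n = -m then -(γ - 1/2) * ((m : ℂ) ^ 2 + m) / 3 else 0)
  | .U m, .L n => sgl (.U (m + n)) (m : ℂ)
      + sgl .C (if m = -n then (γ - 1/2) * ((n : ℂ) ^ 2 + n) / 3 else 0)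
  | .L m, .Tp i n => sgl (.Tp i (m + n)) (-(n : ℂ))
  | .Tp i m, .L n => sgl (.Tp i (m + n)) (m : ℂ)
  | .L m, .Tm i n => sgl (.Tm i (m + n)) (-(n : ℂ))
  | .Tm i m, .L n => sgl (.Tm i (m + n)) (m : ℂ)
  | .L m, .G p k => sgl (.G p (m + k)) ((m : ℂ) / 2 - k - 1/2)
  | .G p k, .L m => sgl (.G p (m + k)) ((k : ℂ) + 1/2 - (m : ℂ) / 2)
  | .L m, .Q p k => sgl (.Q p (m + k)) (-((m : ℂ) / 2 + k + 1/2))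
  | .Q p k, .L m => sgl (.Q p (m + k)) ((m : ℂ) / 2 + k + 1/2)
  | .U m, .U n => sgl .C (if n = -m then -(m : ℂ) / 3 else 0)
  | .U _, .Tp _ _ => 0
  | .Tp _ _, .U _ => 0
  | .U _, .Tm _ _ => 0
  | .Tm _ _, .U _ => 0
  | .U m, .G p k => sgl (.Q p (m + k)) (m : ℂ)
  | .G p k, .U m => sgl (.Q p (m + k)) (-(m : ℂ))
  | .U _, .Q _ _ => 0
  | .Q _ _, .U _ => 0
  | .Tp i m, .Tp j n => (∑ k : Fin 3, sgl (.Tp k (m + n)) (eps3 i j k))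
      + sgl .C (if i = j ∧ n = -m then -(1 - γ) * m / 3 else 0)
  | .Tm i m, .Tm j n => (∑ k : Fin 3, sgl (.Tm k (m + n)) (eps3 i j k))
      + sgl .C (if i = j ∧ n = -m then -γ * m / 3 else 0)
  | .Tp _ _, .Tm _ _ => 0
  | .Tm _ _, .Tp _ _ => 0
  | .Tp i m, .G p k =>
      ∑ q : Fin 4, (sgl (.G q (m + k)) (alP i p q) + sgl (.Q q (m + k)) (-(m : ℂ) * alP i p q))
  | .G p k, .Tp i m =>
      ∑ q : Fin 4, (sgl (.G q (m + k)) (-alP i p q) + sgl (.Q q (m + k)) ((m : ℂ) * alP i p q))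
  | .Tm i m, .G p k =>
      ∑ q : Fin 4, (sgl (.G q (m + k)) (alM i p q) + sgl (.Q q (m + k)) ((m : ℂ) * alM i p q))
  | .G p k, .Tm i m =>
      ∑ q : Fin 4, (sgl (.G q (m + k)) (-alM i p q) + sgl (.Q q (m + k)) (-(m : ℂ) * alM i p q))
  | .Tp i m, .Q p k => ∑ q : Fin 4, sgl (.Q q (m + k)) (alP i p q)
  | .Q p k, .Tp i m => ∑ q : Fin 4, sgl (.Q q (m + k)) (-alP i p q)
  | .Tm i m, .Q p k => ∑ q : Fin 4, sgl (.Q q (m + k)) (alM i p q)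
  | .Q p k, .Tm i m => ∑ q : Fin 4, sgl (.Q q (m + k)) (-alM i p q)
  | .G p a, .G q b => sgl (.L (a + b + 1)) (2 * kdel p q)
      + (∑ i : Fin 3, (sgl (.Tp i (a + b + 1)) (2 * ((b : ℂ) - a) * alP i p q)
          + sgl (.Tm i (a + b + 1)) (2 * ((b : ℂ) - a) * alM i p q)))
      + sgl .C (if p = q ∧ a + b = -1 then ((a : ℂ) ^ 2 + a) / 3 else 0)
  | .Q p a, .G q b => sgl (.U (a + b + 1)) (kdel p q)
      + (∑ i : Fin 3, (sgl (.Tp i (a + b + 1)) (2 * alP i p q)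
          + sgl (.Tm i (a + b + 1)) (-2 * alM i p q)))
      + sgl .C (if p = q ∧ a + b = -1 then -2 * (γ - 1/2) * ((b : ℂ) + 1) / 3 else 0)
  | .G p a, .Q q b => sgl (.U (a + b + 1)) (kdel q p)
      + (∑ i : Fin 3, (sgl (.Tp i (a + b + 1)) (2 * alP i q p)
          + sgl (.Tm i (a + b + 1)) (-2 * alM i q p)))
      + sgl .C (if q = p ∧ b + a = -1 then -2 * (γ - 1/2) * ((a : ℂ) + 1) / 3 else 0)
  | .Q p a, .Q q b => sgl .C (if p = q ∧ a + b = -1 then -(1 : ℂ) / 3 else 0)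

/-- The bilinear extension of the bracket to the whole space. -/
def bk (γ : ℂ) (x y : V) : V :=
  x.sum fun a ca => y.sum fun b cb => (ca * cb) • br γ a b

/-- Parity of a generator: `G` and `Q` are odd, everything else is even. -/
def par : Gen → Bool
  | .G _ _ => true
  | .Q _ _ => true
  | _ => false

/-- `x` is homogeneous of parity `p`. -/
def homog (p : Bool) (x : V) : Prop := ∀ a ∈ x.support, par a = p

/-- The sign `(−1)^{|x||y|}`. -/
def ssgn (p q : Bool) : ℂ := if p && q then -1 else 1

instance : DecidableEq Gen := Classical.decEq Gen

theorem sgl_apply (a e : Gen) (r : ℂ) : sgl a r e = if a = e then r else 0 := by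
  simp only [sgl, Finsupp.single_apply]

theorem br_parity (γ : ℂ) (a b e : Gen) (he : e ∈ (br γ a b).support) :
    par e = xor (par a) (par b) := by
  contrapose! he
  cases a <;> cases b <;> cases e <;> first
    | exact absurd rfl he
    | simp [br, sgl_apply]

/-- The bracket as a bilinear map. -/
def bkL (γ : ℂ) : V →ₗ[ℂ] V →ₗ[ℂ] V :=
  Finsupp.lsum ℂ fun a => LinearMap.toSpanSingleton ℂ _ (Finsupp.linearCombination ℂ (br γ a))

theorem bkL_apply (γ : ℂ) (x y : V) : bkL γ x y = bk γ x y := by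
  simp [bkL, bk, Finsupp.sum, Finsupp.linearCombination_apply, Finset.smul_sum, mul_smul,
    LinearMap.sum_apply]

theorem bkL_sgl (γ : ℂ) (a b : Gen) (r s : ℂ) : bkL γ (sgl a r) (sgl b s) = (r * s) • br γ a b := by
  simp [bkL, sgl, mul_smul]

/-- A general even element of mode `N` (the central part only occurs in mode `0`). -/
def ev (N : ℤ) (l u : ℂ) (P M : Fin 3 → ℂ) (c : ℂ) : V :=
  sgl (.L N) l + sgl (.U N) u + (∑ i, sgl (.Tp i N) (P i)) + (∑ i, sgl (.Tm i N) (M i))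
    + sgl .C (if N = 0 then c else 0)

/-- A general odd element of mode `N + 1/2`. -/
def od (N : ℤ) (G Q : Fin 4 → ℂ) : V :=
  (∑ p, sgl (.G p N) (G p)) + ∑ p, sgl (.Q p N) (Q p)

/-- The Lie bracket of `so(3)`. -/
def crs (P P' : Fin 3 → ℂ) : Fin 3 → ℂ :=
  ![P 1 * P' 2 - P 2 * P' 1, P 2 * P' 0 - P 0 * P' 2, P 0 * P' 1 - P 1 * P' 0]

/-- The action `q ↦ ∑ P_i α^{+i}_{pq} G_p` of the first `so(3)` on the vector representation. -/
def actP (P : Fin 3 → ℂ) (G : Fin 4 → ℂ) : Fin 4 → ℂ :=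
  ![(-P 0 * G 3 + P 1 * G 2 - P 2 * G 1) / 2, (-P 0 * G 2 - P 1 * G 3 + P 2 * G 0) / 2,
    (P 0 * G 1 - P 1 * G 0 - P 2 * G 3) / 2, (P 0 * G 0 + P 1 * G 1 + P 2 * G 2) / 2]

/-- The action `q ↦ ∑ M_i α^{-i}_{pq} G_p` of the second `so(3)` on the vector representation. -/
def actM (M : Fin 3 → ℂ) (G : Fin 4 → ℂ) : Fin 4 → ℂ :=
  ![(M 0 * G 3 + M 1 * G 2 - M 2 * G 1) / 2, (-M 0 * G 2 + M 1 * G 3 + M 2 * G 0) / 2,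
    (M 0 * G 1 - M 1 * G 0 + M 2 * G 3) / 2, (-M 0 * G 0 - M 1 * G 1 - M 2 * G 2) / 2]

/-- The self-dual part `i ↦ ∑ α^{+i}_{pq} G_p G'_q` of the wedge product. -/
def wedP (G G' : Fin 4 → ℂ) : Fin 3 → ℂ :=
  ![(G 0 * G' 3 - G 3 * G' 0 + G 1 * G' 2 - G 2 * G' 1) / 2,
    (G 1 * G' 3 - G 3 * G' 1 + G 2 * G' 0 - G 0 * G' 2) / 2,
    (G 2 * G' 3 - G 3 * G' 2 + G 0 * G' 1 - G 1 * G' 0) / 2]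

/-- The anti-self-dual part `i ↦ ∑ α^{-i}_{pq} G_p G'_q` of the wedge product. -/
def wedM (G G' : Fin 4 → ℂ) : Fin 3 → ℂ :=
  ![(-G 0 * G' 3 + G 3 * G' 0 + G 1 * G' 2 - G 2 * G' 1) / 2,
    (-G 1 * G' 3 + G 3 * G' 1 + G 2 * G' 0 - G 0 * G' 2) / 2,
    (-G 2 * G' 3 + G 3 * G' 2 + G 0 * G' 1 - G 1 * G' 0) / 2]

theorem crs_eq_sum (P P' : Fin 3 → ℂ) (k : Fin 3) :
    crs P P' k = ∑ i, ∑ j, P i * P' j * eps3 i j k := by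
  fin_cases k <;> simp [crs, eps3, Fin.sum_univ_three] <;> ring

theorem actP_eq_sum (P : Fin 3 → ℂ) (G : Fin 4 → ℂ) (q : Fin 4) :
    actP P G q = ∑ i, ∑ p, P i * G p * alP i p q := by
  fin_cases q <;>
    simp [actP, alP, eps4, eps3, Fin.sum_univ_three, Fin.sum_univ_four] <;> ring

theorem actM_eq_sum (M : Fin 3 → ℂ) (G : Fin 4 → ℂ) (q : Fin 4) :
    actM M G q = ∑ i, ∑ p, M i * G p * alM i p q := by
  fin_cases q <;>
    simp [actM, alM, eps4, eps3, Fin.sum_univ_three, Fin.sum_univ_four] <;> ring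

theorem wedP_eq_sum (G G' : Fin 4 → ℂ) (i : Fin 3) :
    wedP G G' i = ∑ p, ∑ q, G p * G' q * alP i p q := by
  fin_cases i <;> simp [wedP, alP, eps4, eps3, Fin.sum_univ_four] <;> ring

theorem wedM_eq_sum (G G' : Fin 4 → ℂ) (i : Fin 3) :
    wedM G G' i = ∑ p, ∑ q, G p * G' q * alM i p q := by
  fin_cases i <;> simp [wedM, alM, eps4, eps3, Fin.sum_univ_four] <;> ring

set_option maxHeartbeats 4000000 in
theorem bkL_ev_ev (γ : ℂ) (m n : ℤ) (l u c l' u' c' : ℂ) (P M P' M' : Fin 3 → ℂ) :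
    bkL γ (ev m l u P M c) (ev n l' u' P' M' c') =
      ev (m + n) ((m - n) * (l * l')) (m * (u * l') - n * (l * u'))
        (fun k => m * (P k * l') - n * (l * P' k) + crs P P' k)
        (fun k => m * (M k * l') - n * (l * M' k) + crs M M' k)
        ((m ^ 3 - m) / 12 * (l * l') - (γ - 1 / 2) * (m ^ 2 + m) / 3 * (l * u')
          + (γ - 1 / 2) * (n ^ 2 + n) / 3 * (u * l') - m / 3 * (u * u')
          - (1 - γ) * m / 3 * ∑ i, P i * P' i - γ * m / 3 * ∑ i, M i * M' i) := by
  simp only [ev, map_add, LinearMap.add_apply, map_sum, LinearMap.sum_apply, bkL_sgl, br,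
    smul_zero, add_zero, Finset.sum_const_zero, eq_neg_iff_add_eq_zero, add_comm n m,
    crs_eq_sum]
  ext (_ | t | t | ⟨k, t⟩ | ⟨k, t⟩ | ⟨k, t⟩ | ⟨k, t⟩) <;>
    simp [sgl_apply, ite_and, Finset.sum_add_distrib] <;> split_ifs <;>
    (try simp [Fin.sum_univ_three]) <;> ring

set_option maxHeartbeats 4000000 in
theorem bkL_ev_od (γ : ℂ) (m k : ℤ) (l u c : ℂ) (P M : Fin 3 → ℂ) (G Q : Fin 4 → ℂ) :
    bkL γ (ev m l u P M c) (od k G Q) =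
      od (m + k) (fun q => (m / 2 - k - 1 / 2) * (l * G q) + actP P G q + actM M G q)
        (fun q => -(m / 2 + k + 1 / 2) * (l * Q q) + m * (u * G q) + actP P Q q + actM M Q q
          - m * actP P G q + m * actM M G q) := by
  simp only [ev, od, map_add, LinearMap.add_apply, map_sum, LinearMap.sum_apply, bkL_sgl, br,
    smul_zero, actP_eq_sum, actM_eq_sum]
  ext (_ | t | t | ⟨q, t⟩ | ⟨q, t⟩ | ⟨q, t⟩ | ⟨q, t⟩) <;>
    simp [sgl_apply, ite_and, Finset.sum_add_distrib] <;> split_ifs <;>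
    simp [Fin.sum_univ_three, Fin.sum_univ_four] <;> ring

set_option maxHeartbeats 4000000 in
theorem bkL_od_ev (γ : ℂ) (m k : ℤ) (l u c : ℂ) (P M : Fin 3 → ℂ) (G Q : Fin 4 → ℂ) :
    bkL γ (od k G Q) (ev m l u P M c) =
      od (m + k) (fun q => -((m / 2 - k - 1 / 2) * (l * G q) + actP P G q + actM M G q))
        (fun q => -(-(m / 2 + k + 1 / 2) * (l * Q q) + m * (u * G q) + actP P Q q + actM M Q q
          - m * actP P G q + m * actM M G q)) := by
  simp only [ev, od, map_add, LinearMap.add_apply, map_sum, LinearMap.sum_apply, bkL_sgl, br,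
    smul_zero, actP_eq_sum, actM_eq_sum]
  ext (_ | t | t | ⟨q, t⟩ | ⟨q, t⟩ | ⟨q, t⟩ | ⟨q, t⟩) <;>
    simp [sgl_apply, ite_and, Finset.sum_add_distrib] <;> split_ifs <;>
    simp [Fin.sum_univ_three, Fin.sum_univ_four] <;> ring

set_option maxHeartbeats 4000000 in
theorem bkL_od_od (γ : ℂ) (a b : ℤ) (G Q G' Q' : Fin 4 → ℂ) :
    bkL γ (od a G Q) (od b G' Q') =
      ev (a + b + 1) (2 * ∑ p, G p * G' p) (∑ p, (Q p * G' p + G p * Q' p))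
        (fun i => 2 * (b - a) * wedP G G' i + 2 * wedP Q G' i + 2 * wedP Q' G i)
        (fun i => 2 * (b - a) * wedM G G' i - 2 * wedM Q G' i - 2 * wedM Q' G i)
        (∑ p, ((a ^ 2 + a) / 3 * (G p * G' p) - 2 * (γ - 1 / 2) * (b + 1) / 3 * (Q p * G' p)
          - 2 * (γ - 1 / 2) * (a + 1) / 3 * (G p * Q' p) - 1 / 3 * (Q p * Q' p))) := by
  simp only [ev, od, map_add, LinearMap.add_apply, map_sum, LinearMap.sum_apply, bkL_sgl, br,
    eq_neg_iff_add_eq_zero, add_comm b a, wedP_eq_sum, wedM_eq_sum]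
  ext (_ | t | t | ⟨i, t⟩ | ⟨i, t⟩ | ⟨i, t⟩ | ⟨i, t⟩) <;>
    simp [sgl_apply, ite_and, kdel, Finset.sum_add_distrib] <;> split_ifs <;>
    simp [Fin.sum_univ_four] <;> ring

theorem ev_cyc_eq_zero {N₁ N₂ N₃ : ℤ} {s₁ s₂ s₃ l₁ l₂ l₃ u₁ u₂ u₃ c₁ c₂ c₃ : ℂ}
    {P₁ P₂ P₃ M₁ M₂ M₃ : Fin 3 → ℂ} (h₂ : N₂ = N₁) (h₃ : N₃ = N₁)
    (hl : s₁ * l₁ + s₂ * l₂ + s₃ * l₃ = 0) (hu : s₁ * u₁ + s₂ * u₂ + s₃ * u₃ = 0)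
    (hP : ∀ i, s₁ * P₁ i + s₂ * P₂ i + s₃ * P₃ i = 0)
    (hM : ∀ i, s₁ * M₁ i + s₂ * M₂ i + s₃ * M₃ i = 0)
    (hc : N₁ = 0 → s₁ * c₁ + s₂ * c₂ + s₃ * c₃ = 0) :
    s₁ • ev N₁ l₁ u₁ P₁ M₁ c₁ + s₂ • ev N₂ l₂ u₂ P₂ M₂ c₂ + s₃ • ev N₃ l₃ u₃ P₃ M₃ c₃ = 0 := by
  subst h₂ h₃
  ext (_ | t | t | ⟨i, t⟩ | ⟨i, t⟩ | ⟨i, t⟩ | ⟨i, t⟩) <;>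
    simp only [ev, Finsupp.add_apply, Finsupp.smul_apply, Finsupp.finsetSum_apply, sgl_apply,
      Gen.L.injEq, Gen.U.injEq, Gen.Tp.injEq, Gen.Tm.injEq, reduceCtorEq, if_false, if_true,
      ite_and, Finset.sum_ite_eq', Finset.mem_univ, Finset.sum_const_zero, add_zero, zero_add,
      smul_eq_mul, mul_zero, Finsupp.zero_apply] <;>
    split_ifs <;> simp_all

theorem od_cyc_eq_zero {N₁ N₂ N₃ : ℤ} {s₁ s₂ s₃ : ℂ} {G₁ G₂ G₃ Q₁ Q₂ Q₃ : Fin 4 → ℂ}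
    (h₂ : N₂ = N₁) (h₃ : N₃ = N₁) (hG : ∀ q, s₁ * G₁ q + s₂ * G₂ q + s₃ * G₃ q = 0)
    (hQ : ∀ q, s₁ * Q₁ q + s₂ * Q₂ q + s₃ * Q₃ q = 0) :
    s₁ • od N₁ G₁ Q₁ + s₂ • od N₂ G₂ Q₂ + s₃ • od N₃ G₃ Q₃ = 0 := by
  subst h₂ h₃
  ext (_ | t | t | ⟨i, t⟩ | ⟨i, t⟩ | ⟨i, t⟩ | ⟨i, t⟩) <;>
    simp only [od, Finsupp.add_apply, Finsupp.smul_apply, Finsupp.finsetSum_apply, sgl_apply,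
      Gen.G.injEq, Gen.Q.injEq, reduceCtorEq, if_false,
      ite_and, Finset.sum_ite_eq', Finset.mem_univ, if_true, Finset.sum_const_zero, add_zero,
      zero_add, smul_eq_mul, mul_zero, Finsupp.zero_apply] <;>
    split_ifs <;> simp_all

/-- The cyclic sum in the Jacobi identity with prescribed signs. -/
def jac (γ s₁ s₂ s₃ : ℂ) (x y z : V) : V :=
  s₁ • bkL γ (bkL γ x y) z + s₂ • bkL γ (bkL γ y z) x + s₃ • bkL γ (bkL γ z x) y

set_option maxHeartbeats 4000000 in
theorem jac_ev_ev_ev (γ : ℂ) (m n k : ℤ) (l₁ u₁ c₁ l₂ u₂ c₂ l₃ u₃ c₃ : ℂ)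
    (P₁ M₁ P₂ M₂ P₃ M₃ : Fin 3 → ℂ) :
    jac γ 1 1 1 (ev m l₁ u₁ P₁ M₁ c₁) (ev n l₂ u₂ P₂ M₂ c₂) (ev k l₃ u₃ P₃ M₃ c₃) = 0 := by
  simp only [jac, bkL_ev_ev]
  refine ev_cyc_eq_zero (by ring) (by ring) ?_ ?_ ?_ ?_ ?_
  · push_cast; ring
  · push_cast; ring
  · intro i
    push_cast
    fin_cases i <;> simp [crs] <;> ring
  · intro i
    push_cast
    fin_cases i <;> simp [crs] <;> ring
  · intro h
    obtain rfl : k = -m - n := by omega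
    simp [crs, Fin.sum_univ_three]
    ring

set_option maxHeartbeats 4000000 in
theorem jac_ev_ev_od (γ : ℂ) (m n k : ℤ) (l₁ u₁ c₁ l₂ u₂ c₂ : ℂ)
    (P₁ M₁ P₂ M₂ : Fin 3 → ℂ) (G Q : Fin 4 → ℂ) :
    jac γ 1 1 1 (ev m l₁ u₁ P₁ M₁ c₁) (ev n l₂ u₂ P₂ M₂ c₂) (od k G Q) = 0 := by
  simp only [jac, bkL_ev_ev, bkL_ev_od, bkL_od_ev]
  refine od_cyc_eq_zero (by ring) (by ring) ?_ ?_
  · intro q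
    push_cast
    fin_cases q <;> simp [crs, actP, actM] <;> ring
  · intro q
    push_cast
    fin_cases q <;> simp [crs, actP, actM] <;> ring

set_option maxHeartbeats 4000000 in
theorem jac_ev_od_od (γ : ℂ) (m n k : ℤ) (l u c : ℂ)
    (P M : Fin 3 → ℂ) (G₁ Q₁ G₂ Q₂ : Fin 4 → ℂ) :
    jac γ 1 1 (-1) (ev m l u P M c) (od n G₁ Q₁) (od k G₂ Q₂) = 0 := by
  simp only [jac, bkL_ev_ev, bkL_ev_od, bkL_od_ev, bkL_od_od]
  refine ev_cyc_eq_zero (by ring) (by ring) ?_ ?_ ?_ ?_ ?_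
  · simp [actP, actM, Fin.sum_univ_four]; ring
  · simp [actP, actM, Fin.sum_univ_four]; ring
  · intro i
    push_cast
    fin_cases i <;> simp [crs, actP, actM, wedP, Fin.sum_univ_four] <;> ring
  · intro i
    push_cast
    fin_cases i <;> simp [crs, actP, actM, wedM, Fin.sum_univ_four] <;> ring
  · intro h
    obtain rfl : k = -m - n - 1 := by omega
    simp [actP, actM, wedP, wedM, Fin.sum_univ_four, Fin.sum_univ_three]
    ring

set_option maxHeartbeats 4000000 in
theorem jac_od_od_od (γ : ℂ) (m n k : ℤ) (G₁ Q₁ G₂ Q₂ G₃ Q₃ : Fin 4 → ℂ) :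
    jac γ (-1) (-1) (-1) (od m G₁ Q₁) (od n G₂ Q₂) (od k G₃ Q₃) = 0 := by
  simp only [jac, bkL_ev_od, bkL_od_od]
  refine od_cyc_eq_zero (by ring) (by ring) ?_ ?_
  · intro q
    push_cast
    fin_cases q <;> simp [actP, actM, wedP, wedM, Fin.sum_univ_four] <;> ring
  · intro q
    push_cast
    fin_cases q <;> simp [actP, actM, wedP, wedM, Fin.sum_univ_four] <;> ring

theorem jac_rotate (γ s₁ s₂ s₃ : ℂ) (x y z : V) :
    jac γ s₁ s₂ s₃ x y z = jac γ s₂ s₃ s₁ y z x := by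
  simp only [jac]
  abel

theorem jac_zero_left (γ s₁ s₂ s₃ : ℂ) (y z : V) : jac γ s₁ s₂ s₃ 0 y z = 0 := by
  simp [jac]

theorem jac_add_left (γ s₁ s₂ s₃ : ℂ) (x x' y z : V) :
    jac γ s₁ s₂ s₃ (x + x') y z = jac γ s₁ s₂ s₃ x y z + jac γ s₁ s₂ s₃ x' y z := by
  simp only [jac, map_add, LinearMap.add_apply, smul_add]
  abel

theorem ev_eq_smul {N₁ N₂ : ℤ} {s l₁ l₂ u₁ u₂ c₁ c₂ : ℂ} {P₁ P₂ M₁ M₂ : Fin 3 → ℂ}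
    (h : N₂ = N₁) (hl : l₁ = s * l₂) (hu : u₁ = s * u₂) (hP : ∀ i, P₁ i = s * P₂ i)
    (hM : ∀ i, M₁ i = s * M₂ i) (hc : N₁ = 0 → c₁ = s * c₂) :
    ev N₁ l₁ u₁ P₁ M₁ c₁ = s • ev N₂ l₂ u₂ P₂ M₂ c₂ := by
  have := ev_cyc_eq_zero (s₁ := 1) (s₂ := -s) (s₃ := 0) (N₁ := N₁) (l₁ := l₁) (l₂ := l₂) (l₃ := 0)
    (u₁ := u₁) (u₂ := u₂) (u₃ := 0) (c₁ := c₁) (c₂ := c₂) (c₃ := 0) (P₁ := P₁) (P₂ := P₂)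
    (P₃ := 0) (M₁ := M₁) (M₂ := M₂) (M₃ := 0) h rfl (by simp [hl]) (by simp [hu])
    (by simp [hP]) (by simp [hM]) (fun h => by simp [hc h])
  simpa [add_neg_eq_zero] using this

theorem skew_ev_ev (γ : ℂ) (m n : ℤ) (l u c l' u' c' : ℂ) (P M P' M' : Fin 3 → ℂ) :
    bkL γ (ev m l u P M c) (ev n l' u' P' M' c')
      = (-1 : ℂ) • bkL γ (ev n l' u' P' M' c') (ev m l u P M c) := by
  rw [bkL_ev_ev, bkL_ev_ev]
  refine ev_eq_smul (add_comm n m) ?_ ?_ ?_ ?_ ?_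
  · ring
  · ring
  · intro i
    fin_cases i <;> simp [crs] <;> ring
  · intro i
    fin_cases i <;> simp [crs] <;> ring
  · intro h
    obtain rfl : n = -m := by omega
    simp [Fin.sum_univ_three]
    ring

theorem skew_od_od (γ : ℂ) (m n : ℤ) (G Q G' Q' : Fin 4 → ℂ) :
    bkL γ (od m G Q) (od n G' Q') = (1 : ℂ) • bkL γ (od n G' Q') (od m G Q) := by
  rw [bkL_od_od, bkL_od_od]
  refine ev_eq_smul (congrArg (· + 1) (add_comm n m)) ?_ ?_ ?_ ?_ ?_
  · simp [Fin.sum_univ_four]; ring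
  · simp [Fin.sum_univ_four]; ring
  · intro i
    fin_cases i <;> simp [wedP] <;> ring
  · intro i
    fin_cases i <;> simp [wedM] <;> ring
  · intro h
    obtain rfl : n = -m - 1 := by omega
    simp [Fin.sum_univ_four]
    ring

theorem skew_ev_od (γ : ℂ) (m k : ℤ) (l u c : ℂ) (P M : Fin 3 → ℂ) (G Q : Fin 4 → ℂ) :
    bkL γ (ev m l u P M c) (od k G Q) = -bkL γ (od k G Q) (ev m l u P M c) := by
  rw [bkL_ev_od, bkL_od_ev]
  simp [od, sgl, ← Finset.sum_neg_distrib, add_comm]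

/-- `x` is a general element of parity `p` concentrated in a single mode. -/
def IsMode : Bool → V → Prop
  | false, x => ∃ N l u P M c, x = ev N l u P M c
  | true, x => ∃ N G Q, x = od N G Q

theorem isMode_single (a : Gen) (r : ℂ) : IsMode (par a) (Finsupp.single a r) := by
  cases a with
  | C => exact ⟨0, 0, 0, 0, 0, r, by simp [ev, sgl]⟩
  | L m => exact ⟨m, r, 0, 0, 0, 0, by simp [ev, sgl]⟩
  | U m => exact ⟨m, 0, r, 0, 0, 0, by simp [ev, sgl]⟩
  | Tp i m => exact ⟨m, 0, 0, Pi.single i r, 0, 0, by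
      simp [ev, sgl, Pi.single_apply, apply_ite (Finsupp.single _)]⟩
  | Tm i m => exact ⟨m, 0, 0, 0, Pi.single i r, 0, by
      simp [ev, sgl, Pi.single_apply, apply_ite (Finsupp.single _)]⟩
  | G p k => exact ⟨k, Pi.single p r, 0, by
      simp [od, sgl, Pi.single_apply, apply_ite (Finsupp.single _)]⟩
  | Q p k => exact ⟨k, 0, Pi.single p r, by
      simp [od, sgl, Pi.single_apply, apply_ite (Finsupp.single _)]⟩

theorem homog_induction {p : Bool} {motive : V → Prop} (zero : motive 0)
    (add : ∀ x y, motive x → motive y → motive (x + y)) (mode : ∀ x, IsMode p x → motive x)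
    {x : V} (hx : homog p x) : motive x := by
  rw [← Finsupp.sum_single x]
  exact Finset.sum_induction _ motive add zero fun a ha => mode _ (hx a ha ▸ isMode_single a _)

theorem skew_of_isMode (γ : ℂ) {p q : Bool} {x y : V} (hx : IsMode p x) (hy : IsMode q y) :
    bkL γ x y = (-ssgn p q) • bkL γ y x := by
  cases p <;> cases q
  · obtain ⟨_, _, _, _, _, _, rfl⟩ := hx
    obtain ⟨_, _, _, _, _, _, rfl⟩ := hy
    simpa [ssgn] using skew_ev_ev ..
  · obtain ⟨_, _, _, _, _, _, rfl⟩ := hx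
    obtain ⟨_, _, _, rfl⟩ := hy
    simpa [ssgn] using skew_ev_od ..
  · obtain ⟨_, _, _, rfl⟩ := hx
    obtain ⟨_, _, _, _, _, _, rfl⟩ := hy
    simp [ssgn, skew_ev_od]
  · obtain ⟨_, _, _, rfl⟩ := hx
    obtain ⟨_, _, _, rfl⟩ := hy
    simpa [ssgn] using skew_od_od ..

theorem jac_of_isMode (γ : ℂ) {p q r : Bool} {x y z : V} (hx : IsMode p x) (hy : IsMode q y)
    (hz : IsMode r z) : jac γ (ssgn p r) (ssgn q p) (ssgn r q) x y z = 0 := by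
  cases p <;> cases q <;> cases r <;> simp only [IsMode] at hx hy hz <;>
    obtain ⟨_, _, _, hx⟩ := hx <;> obtain ⟨_, _, _, hy⟩ := hy <;> obtain ⟨_, _, _, hz⟩ := hz <;>
    (try obtain ⟨_, _, _, rfl⟩ := hx) <;> (try obtain ⟨_, _, _, rfl⟩ := hy) <;>
    (try obtain ⟨_, _, _, rfl⟩ := hz) <;>
    simp only [ssgn, Bool.and_true, Bool.and_false, Bool.false_eq_true, if_true, if_false]
  · exact jac_ev_ev_ev ..
  · exact jac_ev_ev_od ..
  · rw [jac_rotate, jac_rotate]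
    exact jac_ev_ev_od ..
  · exact jac_ev_od_od ..
  · rw [jac_rotate]
    exact jac_ev_ev_od ..
  · rw [jac_rotate]
    exact jac_ev_od_od ..
  · rw [jac_rotate, jac_rotate]
    exact jac_ev_od_od ..
  · exact jac_od_od_od ..

theorem skew_of_homog (γ : ℂ) {p q : Bool} {x y : V} (hx : homog p x) (hy : homog q y) :
    bkL γ x y = (-ssgn p q) • bkL γ y x := by
  refine homog_induction (motive := fun x => bkL γ x y = (-ssgn p q) • bkL γ y x) (by simp)
    (fun x x' h h' => ?_) (fun x hx => ?_) hx
  · rw [map_add, LinearMap.add_apply, map_add, smul_add, h, h']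
  refine homog_induction (motive := fun y => bkL γ x y = (-ssgn p q) • bkL γ y x) (by simp)
    (fun y y' h h' => ?_) (fun y hy => skew_of_isMode γ hx hy) hy
  rw [map_add, map_add, LinearMap.add_apply, smul_add, h, h']

theorem jac_of_homog (γ : ℂ) {p q r : Bool} {x y z : V} (hx : homog p x) (hy : homog q y)
    (hz : homog r z) : jac γ (ssgn p r) (ssgn q p) (ssgn r q) x y z = 0 := by
  refine homog_induction (motive := fun x => jac γ _ _ _ x y z = 0) (jac_zero_left ..)
    (fun x x' h h' => by rw [jac_add_left, h, h', add_zero]) (fun x hx => ?_) hx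
  rw [jac_rotate]
  refine homog_induction (motive := fun y => jac γ _ _ _ y z x = 0) (jac_zero_left ..)
    (fun y y' h h' => by rw [jac_add_left, h, h', add_zero]) (fun y hy => ?_) hy
  rw [jac_rotate]
  refine homog_induction (motive := fun z => jac γ _ _ _ z x y = 0) (jac_zero_left ..)
    (fun z z' h h' => by rw [jac_add_left, h, h', add_zero]) (fun z hz => ?_) hz
  rw [jac_rotate]
  exact jac_of_isMode γ hx hy hz

/-- For every `γ ∈ ℂ`, the bracket table of the large `N = 4` superconformal algebra
`g(γ)` defines a Lie superalgebra: it preserves the grading and, on homogeneous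
elements, satisfies super skew-symmetry and the super Jacobi identity. -/
theorem gGamma_is_lie_superalgebra (γ : ℂ) :
    (∀ a b : Gen, ∀ e ∈ (br γ a b).support, par e = xor (par a) (par b)) ∧
    (∀ (px py : Bool) (x y : V), homog px x → homog py y →
      bk γ x y = (-ssgn px py) • bk γ y x) ∧
    (∀ (px py pz : Bool) (x y z : V), homog px x → homog py y → homog pz z →
      ssgn px pz • bk γ (bk γ x y) z + ssgn py px • bk γ (bk γ y z) x
        + ssgn pz py • bk γ (bk γ z x) y = 0) := by
  refine ⟨br_parity γ, fun px py x y hx hy => ?_, fun px py pz x y z hx hy hz => ?_⟩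
  · simpa only [bkL_apply] using skew_of_homog γ hx hy
  · simpa only [jac, bkL_apply] using jac_of_homog γ hx hy hz

end LargeN4Gamma

end
end

section
/- The untwisted large N=4 bracket table defines a Lie superalgebra g (the centerless large N=4 superconformal algebra): on the ℤ/2-graded complex vector space with even basis {L_m, U_m, T^{+i}_m, T^{−i}_m : m ∈ ℤ, i = 1,2,3} and odd basis {G^p_s, Q^p_s : s ∈ ℤ+1/2, p = 1,…,4}, the unique bilinear bracket determined by the untwisted large N=4 bracket table satisfies super skew-symmetry and the super Jacobi identity. -/
noncomputable section

namespace LargeN4Untwisted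

/-- The totally antisymmetric symbol on `Fin 3` with `ε_{123} = 1`. -/
def eps3 (i j k : Fin 3) : ℂ :=
  if (i, j, k) = (0, 1, 2) ∨ (i, j, k) = (1, 2, 0) ∨ (i, j, k) = (2, 0, 1) then 1
  else if (i, j, k) = (2, 1, 0) ∨ (i, j, k) = (1, 0, 2) ∨ (i, j, k) = (0, 2, 1) then -1
  else 0

/-- The antisymmetric symbol with indices in `Fin 4`, `0` if any index is `4` (i.e. `3`). -/
def eps4 (i : Fin 3) (p q : Fin 4) : ℂ :=
  if hp : (p : ℕ) < 3 then
    if hq : (q : ℕ) < 3 then eps3 i ⟨p, hp⟩ ⟨q, hq⟩ else 0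
  else 0

/-- `α^{+i}_{pq} = (1/2)(δ_{ip}δ_{4q} − δ_{iq}δ_{4p}) + (1/2)ε_{ipq}`. -/
def alP (i : Fin 3) (p q : Fin 4) : ℂ :=
  (1 / 2) * ((if (p : ℕ) = (i : ℕ) then 1 else 0) * (if q = 3 then 1 else 0)
    - (if (q : ℕ) = (i : ℕ) then 1 else 0) * (if p = 3 then 1 else 0))
  + (1 / 2) * eps4 i p q

/-- `α^{−i}_{pq} = −(1/2)(δ_{ip}δ_{4q} − δ_{iq}δ_{4p}) + (1/2)ε_{ipq}`. -/
def alM (i : Fin 3) (p q : Fin 4) : ℂ :=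
  -(1 / 2) * ((if (p : ℕ) = (i : ℕ) then 1 else 0) * (if q = 3 then 1 else 0)
    - (if (q : ℕ) = (i : ℕ) then 1 else 0) * (if p = 3 then 1 else 0))
  + (1 / 2) * eps4 i p q

/-- Basis of the centerless large `N = 4` superconformal algebra `g`:
even generators `L_m, U_m, T^{±i}_m` (`m ∈ ℤ`); odd generators `G^p_s, Q^p_s`,
`s ∈ ℤ + 1/2`, encoded as `G p k ↦ G^p_{k+1/2}`, `Q p k ↦ Q^p_{k+1/2}`. -/
inductive Gen : Type
  | L : ℤ → Gen
  | U : ℤ → Gen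
  | Tp : Fin 3 → ℤ → Gen
  | Tm : Fin 3 → ℤ → Gen
  | G : Fin 4 → ℤ → Gen
  | Q : Fin 4 → ℤ → Gen

/-- The underlying vector space: formal ℂ-linear combinations of generators. -/
abbrev V := Gen →₀ ℂ

/-- A scalar multiple of a single basis vector. -/
def sgl (a : Gen) (c : ℂ) : V := Finsupp.single a c

/-- Kronecker delta. -/
def kdel {n : ℕ} (i j : Fin n) : ℂ := if i = j then 1 else 0

/-- The untwisted large `N = 4` bracket table on basis elements (the reversed-order
brackets are the ones forced by super skew-symmetry). -/
def br : Gen → Gen → V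
  | .L m, .L n => sgl (.L (m + n)) ((m : ℂ) - n)
  | .L m, .U n => sgl (.U (m + n)) (-(n : ℂ))
  | .U m, .L n => sgl (.U (m + n)) (m : ℂ)
  | .L m, .Tp i n => sgl (.Tp i (m + n)) (-(n : ℂ))
  | .Tp i m, .L n => sgl (.Tp i (m + n)) (m : ℂ)
  | .L m, .Tm i n => sgl (.Tm i (m + n)) (-(n : ℂ))
  | .Tm i m, .L n => sgl (.Tm i (m + n)) (m : ℂ)
  | .L m, .G p k => sgl (.G p (m + k)) ((m : ℂ) / 2 - k - 1/2)
  | .G p k, .L m => sgl (.G p (m + k)) ((k : ℂ) + 1/2 - (m : ℂ) / 2)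
  | .L m, .Q p k => sgl (.Q p (m + k)) (-((m : ℂ) / 2 + k + 1/2))
  | .Q p k, .L m => sgl (.Q p (m + k)) ((m : ℂ) / 2 + k + 1/2)
  | .U _, .U _ => 0
  | .U _, .Tp _ _ => 0
  | .Tp _ _, .U _ => 0
  | .U _, .Tm _ _ => 0
  | .Tm _ _, .U _ => 0
  | .U m, .G p k => sgl (.Q p (m + k)) (m : ℂ)
  | .G p k, .U m => sgl (.Q p (m + k)) (-(m : ℂ))
  | .U _, .Q _ _ => 0
  | .Q _ _, .U _ => 0
  | .Tp i m, .Tp j n => ∑ k : Fin 3, sgl (.Tp k (m + n)) (eps3 i j k)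
  | .Tm i m, .Tm j n => ∑ k : Fin 3, sgl (.Tm k (m + n)) (eps3 i j k)
  | .Tp _ _, .Tm _ _ => 0
  | .Tm _ _, .Tp _ _ => 0
  | .Tp i m, .G p k =>
      ∑ q : Fin 4, (sgl (.G q (m + k)) (alP i p q) + sgl (.Q q (m + k)) (-(m : ℂ) * alP i p q))
  | .G p k, .Tp i m =>
      ∑ q : Fin 4, (sgl (.G q (m + k)) (-alP i p q) + sgl (.Q q (m + k)) ((m : ℂ) * alP i p q))
  | .Tm i m, .G p k =>
      ∑ q : Fin 4, (sgl (.G q (m + k)) (alM i p q) + sgl (.Q q (m + k)) ((m : ℂ) * alM i p q))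
  | .G p k, .Tm i m =>
      ∑ q : Fin 4, (sgl (.G q (m + k)) (-alM i p q) + sgl (.Q q (m + k)) (-(m : ℂ) * alM i p q))
  | .Tp i m, .Q p k => ∑ q : Fin 4, sgl (.Q q (m + k)) (alP i p q)
  | .Q p k, .Tp i m => ∑ q : Fin 4, sgl (.Q q (m + k)) (-alP i p q)
  | .Tm i m, .Q p k => ∑ q : Fin 4, sgl (.Q q (m + k)) (alM i p q)
  | .Q p k, .Tm i m => ∑ q : Fin 4, sgl (.Q q (m + k)) (-alM i p q)
  | .G p a, .G q b => sgl (.L (a + b + 1)) (2 * kdel p q)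
      + ∑ i : Fin 3, (sgl (.Tp i (a + b + 1)) (2 * ((b : ℂ) - a) * alP i p q)
          + sgl (.Tm i (a + b + 1)) (2 * ((b : ℂ) - a) * alM i p q))
  | .Q p a, .G q b => sgl (.U (a + b + 1)) (kdel p q)
      + ∑ i : Fin 3, (sgl (.Tp i (a + b + 1)) (2 * alP i p q)
          + sgl (.Tm i (a + b + 1)) (-2 * alM i p q))
  | .G p a, .Q q b => sgl (.U (a + b + 1)) (kdel q p)
      + ∑ i : Fin 3, (sgl (.Tp i (a + b + 1)) (2 * alP i q p)
          + sgl (.Tm i (a + b + 1)) (-2 * alM i q p))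
  | .Q _ _, .Q _ _ => 0

/-- The bilinear extension of the bracket to the whole space. -/
def bk (x y : V) : V :=
  x.sum fun a ca => y.sum fun b cb => (ca * cb) • br a b

/-- Parity of a generator: `G` and `Q` are odd, everything else is even. -/
def par : Gen → Bool
  | .G _ _ => true
  | .Q _ _ => true
  | _ => false

/-- `x` is homogeneous of parity `p`. -/
def homog (p : Bool) (x : V) : Prop := ∀ a ∈ x.support, par a = p

/-- The sign `(−1)^{|x||y|}`. -/
def ssgn (p q : Bool) : ℂ := if p && q then -1 else 1

/-- The bracket `bk` as a bilinear map. -/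
def bracketHom : V →ₗ[ℂ] V →ₗ[ℂ] V :=
  Finsupp.lsum ℂ fun a => LinearMap.toSpanSingleton ℂ (V →ₗ[ℂ] V)
    (Finsupp.lsum ℂ fun b => LinearMap.toSpanSingleton ℂ V (br a b))

theorem bk_eq_bracketHom (x y : V) : bk x y = bracketHom x y := by
  simp [bk, bracketHom, Finsupp.lsum_apply, Finsupp.sum, LinearMap.sum_apply, Finset.smul_sum,
    mul_smul]

theorem bracketHom_sgl (a b : Gen) (c d : ℂ) :
    bracketHom (sgl a c) (sgl b d) = (c * d) • br a b := by
  simp [bracketHom, sgl, mul_smul]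

/-- The basis vector of a generator. -/
def gen (a : Gen) : V := Finsupp.single a 1

theorem sgl_eq_smul (a : Gen) (c : ℂ) : sgl a c = c • gen a := by
  simp [sgl, gen]

/-- The even element `l L_m + u U_m + s_i T^{+i}_m + t_i T^{-i}_m`. -/
def evenElt (m : ℤ) (l u : ℂ) (s t : Fin 3 → ℂ) : V :=
  sgl (.L m) l + sgl (.U m) u + ∑ i, sgl (.Tp i m) (s i) + ∑ i, sgl (.Tm i m) (t i)

/-- The odd element `g_p G^p_{k+1/2} + q_p Q^p_{k+1/2}`. -/
def oddElt (k : ℤ) (g q : Fin 4 → ℂ) : V :=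
  ∑ p, sgl (.G p k) (g p) + ∑ p, sgl (.Q p k) (q p)

theorem evenElt_add (m : ℤ) (l u : ℂ) (s t : Fin 3 → ℂ) (l' u' : ℂ) (s' t' : Fin 3 → ℂ) :
    evenElt m l u s t + evenElt m l' u' s' t' =
      evenElt m (l + l') (u + u') (s + s') (t + t') := by
  simp only [evenElt, sgl, Pi.add_apply, Finsupp.single_add, Finset.sum_add_distrib]
  abel

theorem neg_evenElt (m : ℤ) (l u : ℂ) (s t : Fin 3 → ℂ) :
    -evenElt m l u s t = evenElt m (-l) (-u) (-s) (-t) := by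
  simp only [evenElt, sgl, Pi.neg_apply, Finsupp.single_neg, Finset.sum_neg_distrib]
  abel

theorem evenElt_zero (m : ℤ) : evenElt m 0 0 0 0 = 0 := by
  simp [evenElt, sgl]

theorem oddElt_add (k : ℤ) (g q g' q' : Fin 4 → ℂ) :
    oddElt k g q + oddElt k g' q' = oddElt k (g + g') (q + q') := by
  simp only [oddElt, sgl, Pi.add_apply, Finsupp.single_add, Finset.sum_add_distrib]
  abel

theorem neg_oddElt (k : ℤ) (g q : Fin 4 → ℂ) : -oddElt k g q = oddElt k (-g) (-q) := by
  simp only [oddElt, sgl, Pi.neg_apply, Finsupp.single_neg, Finset.sum_neg_distrib]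
  abel

theorem oddElt_zero (k : ℤ) : oddElt k 0 0 = 0 := by
  simp [oddElt, sgl]

/-- The vector product `ε_{ijk} s_i s'_j`. -/
def cross (s s' : Fin 3 → ℂ) : Fin 3 → ℂ :=
  ![s 1 * s' 2 - s 2 * s' 1, s 2 * s' 0 - s 0 * s' 2, s 0 * s' 1 - s 1 * s' 0]

/-- The action `s_i g_p α^{+i}_{pq}` on the vector representation. -/
def actP (s : Fin 3 → ℂ) (g : Fin 4 → ℂ) : Fin 4 → ℂ :=
  fun q => ∑ i, ∑ p, s i * g p * alP i p q

/-- The action `t_i g_p α^{-i}_{pq}` on the vector representation. -/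
def actM (t : Fin 3 → ℂ) (g : Fin 4 → ℂ) : Fin 4 → ℂ :=
  fun q => ∑ i, ∑ p, t i * g p * alM i p q

/-- The bilinear forms `α^{+i}_{pq} g_p h_q`. -/
def formP (g h : Fin 4 → ℂ) : Fin 3 → ℂ := fun i => ∑ p, ∑ q, g p * h q * alP i p q

/-- The bilinear forms `α^{-i}_{pq} g_p h_q`. -/
def formM (g h : Fin 4 → ℂ) : Fin 3 → ℂ := fun i => ∑ p, ∑ q, g p * h q * alM i p q


theorem cross_apply (s s' : Fin 3 → ℂ) :
    cross s s' 0 = s 1 * s' 2 - s 2 * s' 1 ∧ cross s s' 1 = s 2 * s' 0 - s 0 * s' 2 ∧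
    cross s s' 2 = s 0 * s' 1 - s 1 * s' 0 :=
  ⟨rfl, rfl, rfl⟩

theorem actP_apply (s : Fin 3 → ℂ) (g : Fin 4 → ℂ) :
    actP s g 0 = (s 1 * g 2 - s 2 * g 1 - s 0 * g 3) / 2 ∧
    actP s g 1 = (s 2 * g 0 - s 0 * g 2 - s 1 * g 3) / 2 ∧
    actP s g 2 = (s 0 * g 1 - s 1 * g 0 - s 2 * g 3) / 2 ∧
    actP s g 3 = (s 0 * g 0 + s 1 * g 1 + s 2 * g 2) / 2 := by
  refine ⟨?_, ?_, ?_, ?_⟩ <;>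
    simp [actP, alP, eps4, eps3, Fin.sum_univ_four, Fin.sum_univ_three] <;> ring

theorem actM_apply (t : Fin 3 → ℂ) (g : Fin 4 → ℂ) :
    actM t g 0 = (t 1 * g 2 - t 2 * g 1 + t 0 * g 3) / 2 ∧
    actM t g 1 = (t 2 * g 0 - t 0 * g 2 + t 1 * g 3) / 2 ∧
    actM t g 2 = (t 0 * g 1 - t 1 * g 0 + t 2 * g 3) / 2 ∧
    actM t g 3 = -(t 0 * g 0 + t 1 * g 1 + t 2 * g 2) / 2 := by
  refine ⟨?_, ?_, ?_, ?_⟩ <;>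
    simp [actM, alM, eps4, eps3, Fin.sum_univ_four, Fin.sum_univ_three] <;> ring

theorem formP_apply (g h : Fin 4 → ℂ) :
    formP g h 0 = (g 0 * h 3 - g 3 * h 0 + g 1 * h 2 - g 2 * h 1) / 2 ∧
    formP g h 1 = (g 1 * h 3 - g 3 * h 1 + g 2 * h 0 - g 0 * h 2) / 2 ∧
    formP g h 2 = (g 2 * h 3 - g 3 * h 2 + g 0 * h 1 - g 1 * h 0) / 2 := by
  refine ⟨?_, ?_, ?_⟩ <;>
    simp [formP, alP, eps4, eps3, Fin.sum_univ_four] <;> ring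

theorem formM_apply (g h : Fin 4 → ℂ) :
    formM g h 0 = (g 3 * h 0 - g 0 * h 3 + g 1 * h 2 - g 2 * h 1) / 2 ∧
    formM g h 1 = (g 3 * h 1 - g 1 * h 3 + g 2 * h 0 - g 0 * h 2) / 2 ∧
    formM g h 2 = (g 3 * h 2 - g 2 * h 3 + g 0 * h 1 - g 1 * h 0) / 2 := by
  refine ⟨?_, ?_, ?_⟩ <;>
    simp [formM, alM, eps4, eps3, Fin.sum_univ_four] <;> ring

theorem bracket_even_even (m n : ℤ) (l u : ℂ) (s t : Fin 3 → ℂ) (l' u' : ℂ)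
    (s' t' : Fin 3 → ℂ) :
    bracketHom (evenElt m l u s t) (evenElt n l' u' s' t') =
      evenElt (m + n) ((m - n) * (l * l')) (m * (u * l') - n * (l * u'))
        (((m : ℂ) * l') • s - ((n : ℂ) * l) • s' + cross s s')
        (((m : ℂ) * l') • t - ((n : ℂ) * l) • t' + cross t t') := by
  simp only [evenElt, map_add, LinearMap.add_apply, bracketHom_sgl, br, Fin.sum_univ_three]
  simp [sgl_eq_smul, eps3, cross_apply]
  module

theorem bracket_even_odd (m k : ℤ) (l u : ℂ) (s t : Fin 3 → ℂ) (g q : Fin 4 → ℂ) :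
    bracketHom (evenElt m l u s t) (oddElt k g q) =
      oddElt (m + k) (((m / 2 - k - 1 / 2) * l) • g + actP s g + actM t g)
        ((-(m / 2 + k + 1 / 2) * l) • q + ((m : ℂ) * u) • g + actP s q + actM t q
          - (m : ℂ) • actP s g + (m : ℂ) • actM t g) := by
  simp only [evenElt, oddElt, map_add, LinearMap.add_apply, bracketHom_sgl, br,
    Fin.sum_univ_three, Fin.sum_univ_four]
  simp [sgl_eq_smul, actP_apply, actM_apply, alP, alM, eps4, eps3]
  module

theorem bracket_odd_even (m k : ℤ) (l u : ℂ) (s t : Fin 3 → ℂ) (g q : Fin 4 → ℂ) :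
    bracketHom (oddElt k g q) (evenElt m l u s t) =
      -oddElt (m + k) (((m / 2 - k - 1 / 2) * l) • g + actP s g + actM t g)
        ((-(m / 2 + k + 1 / 2) * l) • q + ((m : ℂ) * u) • g + actP s q + actM t q
          - (m : ℂ) • actP s g + (m : ℂ) • actM t g) := by
  simp only [evenElt, oddElt, map_add, LinearMap.add_apply, bracketHom_sgl, br,
    Fin.sum_univ_three, Fin.sum_univ_four]
  simp [sgl_eq_smul, actP_apply, actM_apply, alP, alM, eps4, eps3]
  module

theorem bracket_odd_odd (a b : ℤ) (g q g' q' : Fin 4 → ℂ) :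
    bracketHom (oddElt a g q) (oddElt b g' q') =
      evenElt (a + b + 1) (2 * ∑ p, g p * g' p) (∑ p, (q p * g' p + g p * q' p))
        ((2 * ((b : ℂ) - a)) • formP g g' + (2 : ℂ) • formP q g' + (2 : ℂ) • formP q' g)
        ((2 * ((b : ℂ) - a)) • formM g g' - (2 : ℂ) • formM q g' - (2 : ℂ) • formM q' g) := by
  simp only [evenElt, oddElt, map_add, LinearMap.add_apply, bracketHom_sgl, br,
    Fin.sum_univ_three, Fin.sum_univ_four]
  simp [sgl_eq_smul, formP_apply, formM_apply, alP, alM, eps4, eps3, kdel]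
  module

theorem jacobi_even_even_even (m n k : ℤ) (l u : ℂ) (s t : Fin 3 → ℂ) (l' u' : ℂ)
    (s' t' : Fin 3 → ℂ) (l'' u'' : ℂ) (s'' t'' : Fin 3 → ℂ) :
    bracketHom (bracketHom (evenElt m l u s t) (evenElt n l' u' s' t')) (evenElt k l'' u'' s'' t'')
    + bracketHom (bracketHom (evenElt n l' u' s' t') (evenElt k l'' u'' s'' t''))
        (evenElt m l u s t)
    + bracketHom (bracketHom (evenElt k l'' u'' s'' t'') (evenElt m l u s t))
        (evenElt n l' u' s' t') = 0 := by
  simp only [bracket_even_even]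
  rw [show n + k + m = m + n + k by ring, show k + m + n = m + n + k by ring,
    evenElt_add, evenElt_add, ← evenElt_zero (m + n + k)]
  congr 1
  · push_cast; ring
  · push_cast; ring
  · ext r; fin_cases r <;> simp [cross_apply] <;> ring
  · ext r; fin_cases r <;> simp [cross_apply] <;> ring

theorem jacobi_even_even_odd (m n k : ℤ) (l u : ℂ) (s t : Fin 3 → ℂ) (l' u' : ℂ)
    (s' t' : Fin 3 → ℂ) (g q : Fin 4 → ℂ) :
    bracketHom (bracketHom (evenElt m l u s t) (evenElt n l' u' s' t')) (oddElt k g q)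
    + bracketHom (bracketHom (evenElt n l' u' s' t') (oddElt k g q)) (evenElt m l u s t)
    + bracketHom (bracketHom (oddElt k g q) (evenElt m l u s t)) (evenElt n l' u' s' t') = 0 := by
  simp only [bracket_even_even, bracket_even_odd, bracket_odd_even, neg_oddElt]
  rw [show m + (n + k) = m + n + k by ring, show n + (m + k) = m + n + k by ring,
    oddElt_add, oddElt_add, ← oddElt_zero (m + n + k)]
  congr 1 <;> ext r <;> fin_cases r <;> simp [cross_apply, actP_apply, actM_apply] <;> ring

theorem jacobi_even_odd_odd (m a b : ℤ) (l u : ℂ) (s t : Fin 3 → ℂ) (g q g' q' : Fin 4 → ℂ) :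
    bracketHom (bracketHom (evenElt m l u s t) (oddElt a g q)) (oddElt b g' q')
    + bracketHom (bracketHom (oddElt a g q) (oddElt b g' q')) (evenElt m l u s t)
    - bracketHom (bracketHom (oddElt b g' q') (evenElt m l u s t)) (oddElt a g q) = 0 := by
  simp only [bracket_odd_odd, bracket_even_odd, bracket_odd_even, bracket_even_even, neg_oddElt]
  rw [show a + b + 1 + m = m + a + b + 1 by ring, show m + b + a + 1 = m + a + b + 1 by ring,
    sub_eq_zero, evenElt_add]
  congr 1
  · simp [actP_apply, actM_apply, Fin.sum_univ_four]; ring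
  · simp [actP_apply, actM_apply, Fin.sum_univ_four]; ring
  · ext r
    fin_cases r <;>
      simp [cross_apply, actP_apply, actM_apply, formP_apply, Fin.sum_univ_four] <;> ring
  · ext r
    fin_cases r <;>
      simp [cross_apply, actP_apply, actM_apply, formM_apply, Fin.sum_univ_four] <;> ring

set_option maxHeartbeats 4000000 in
theorem jacobi_odd_odd_odd (a b c : ℤ) (g q g' q' g'' q'' : Fin 4 → ℂ) :
    bracketHom (bracketHom (oddElt a g q) (oddElt b g' q')) (oddElt c g'' q'')
    + bracketHom (bracketHom (oddElt b g' q') (oddElt c g'' q'')) (oddElt a g q)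
    + bracketHom (bracketHom (oddElt c g'' q'') (oddElt a g q)) (oddElt b g' q') = 0 := by
  simp only [bracket_odd_odd, bracket_even_odd]
  rw [show b + c + 1 + a = a + b + 1 + c by ring, show c + a + 1 + b = a + b + 1 + c by ring,
    oddElt_add, oddElt_add, ← oddElt_zero (a + b + 1 + c)]
  congr 1 <;> ext r <;> fin_cases r <;>
    simp only [Fin.zero_eta, Fin.mk_one, Fin.reduceFinMk, Pi.add_apply, Pi.sub_apply,
      Pi.smul_apply, Pi.zero_apply, smul_eq_mul, actP_apply, actM_apply, formP_apply,
      formM_apply, Fin.sum_univ_four] <;>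
    push_cast <;> ring

/-- `IsElt p x` says that `x` is of the form `evenElt` (for `p = false`) or `oddElt`
(for `p = true`). -/
inductive IsElt : Bool → V → Prop
  | even (m : ℤ) (l u : ℂ) (s t : Fin 3 → ℂ) : IsElt false (evenElt m l u s t)
  | odd (k : ℤ) (g q : Fin 4 → ℂ) : IsElt true (oddElt k g q)

theorem isElt_single (a : Gen) (c : ℂ) : IsElt (par a) (Finsupp.single a c) := by
  cases a with
  | L m => simpa [evenElt, sgl, par] using IsElt.even m c 0 0 0
  | U m => simpa [evenElt, sgl, par] using IsElt.even m 0 c 0 0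
  | Tp i m =>
    rw [show Finsupp.single (Gen.Tp i m) c = evenElt m 0 0 (Pi.single i c) 0 by
      simp [evenElt, sgl, Pi.single_apply, apply_ite (Finsupp.single _)]]
    exact IsElt.even ..
  | Tm i m =>
    rw [show Finsupp.single (Gen.Tm i m) c = evenElt m 0 0 0 (Pi.single i c) by
      simp [evenElt, sgl, Pi.single_apply, apply_ite (Finsupp.single _)]]
    exact IsElt.even ..
  | G p k =>
    rw [show Finsupp.single (Gen.G p k) c = oddElt k (Pi.single p c) 0 by
      simp [oddElt, sgl, Pi.single_apply, apply_ite (Finsupp.single _)]]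
    exact IsElt.odd ..
  | Q p k =>
    rw [show Finsupp.single (Gen.Q p k) c = oddElt k 0 (Pi.single p c) by
      simp [oddElt, sgl, Pi.single_apply, apply_ite (Finsupp.single _)]]
    exact IsElt.odd ..

theorem homog_induction {p : Bool} {P : V → Prop} (zero : P 0)
    (hadd : ∀ x y, P x → P y → P (x + y)) (elt : ∀ x, IsElt p x → P x) {x : V}
    (hx : homog p x) : P x := by
  rw [← Finsupp.sum_single x]
  exact Finset.sum_induction _ P hadd zero fun a ha => elt _ (hx a ha ▸ isElt_single a _)

theorem sgl_mem_supported {p : Bool} {a : Gen} (c : ℂ) (h : par a = p) :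
    sgl a c ∈ Finsupp.supported ℂ ℂ {e | par e = p} :=
  Finsupp.single_mem_supported ℂ c h

theorem br_mem_supported (a b : Gen) :
    br a b ∈ Finsupp.supported ℂ ℂ {e | par e = xor (par a) (par b)} := by
  cases a <;> cases b <;> simp only [br] <;>
    repeat' first
      | (with_reducible refine sgl_mem_supported _ ?_); rfl
      | with_reducible exact Submodule.zero_mem _
      | with_reducible refine Submodule.add_mem _ ?_ ?_
      | with_reducible refine Submodule.sum_mem _ fun _ _ => ?_

theorem IsElt.bracket_skew {px py : Bool} {x y : V} (hx : IsElt px x) (hy : IsElt py y) :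
    bracketHom x y = (-ssgn px py) • bracketHom y x := by
  cases hx with
  | even m l u s t =>
    cases hy with
    | even n l' u' s' t' =>
      simp only [bracket_even_even, ssgn, Bool.and_self, Bool.false_eq_true, if_false, neg_smul,
        one_smul, neg_evenElt]
      rw [add_comm n m]
      congr 1
      · ring
      · ring
      · ext r; fin_cases r <;> simp [cross_apply] <;> ring
      · ext r; fin_cases r <;> simp [cross_apply] <;> ring
    | odd k g q => simp [bracket_even_odd, bracket_odd_even, ssgn]
  | odd k g q =>
    cases hy with
    | even n l' u' s' t' => simp [bracket_even_odd, bracket_odd_even, ssgn]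
    | odd k' g' q' =>
      simp only [bracket_odd_odd, ssgn, Bool.and_self, if_true, neg_neg, one_smul]
      rw [add_comm k' k]
      congr 1
      · simp only [Fin.sum_univ_four]; ring
      · simp only [Fin.sum_univ_four]; ring
      · ext r; fin_cases r <;> simp [formP_apply] <;> ring
      · ext r; fin_cases r <;> simp [formM_apply] <;> ring

theorem IsElt.bracket_jacobi {px py pz : Bool} {x y z : V} (hx : IsElt px x) (hy : IsElt py y)
    (hz : IsElt pz z) :
    ssgn px pz • bracketHom (bracketHom x y) z + ssgn py px • bracketHom (bracketHom y z) x
      + ssgn pz py • bracketHom (bracketHom z x) y = 0 := by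
  cases hx with
  | even m l u s t =>
    cases hy with
    | even n l' u' s' t' =>
      cases hz with
      | even => simpa [ssgn] using jacobi_even_even_even ..
      | odd => simpa [ssgn] using jacobi_even_even_odd ..
    | odd k g q =>
      cases hz with
      | even m' l' u' s' t' =>
        simp only [ssgn, Bool.false_and, Bool.and_false, Bool.false_eq_true, if_false, one_smul]
        rw [← jacobi_even_even_odd m' m k l' u' s' t' l u s t g q]
        abel
      | odd k' g' q' =>
        simp only [ssgn, Bool.false_and, Bool.and_false, Bool.and_self, Bool.false_eq_true,
          if_false, if_true, one_smul, neg_smul]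
        rw [← jacobi_even_odd_odd m k k' l u s t g q g' q']
        abel
  | odd k g q =>
    cases hy with
    | even m l u s t =>
      cases hz with
      | even m' l' u' s' t' =>
        simp only [ssgn, Bool.false_and, Bool.and_false, Bool.false_eq_true, if_false, one_smul]
        rw [← jacobi_even_even_odd m m' k l u s t l' u' s' t' g q]
        abel
      | odd k' g' q' =>
        simp only [ssgn, Bool.false_and, Bool.and_false, Bool.and_self, Bool.false_eq_true,
          if_false, if_true, one_smul, neg_smul]
        rw [← jacobi_even_odd_odd m k' k l u s t g' q' g q]
        abel
    | odd k' g' q' =>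
      cases hz with
      | even m l u s t =>
        simp only [ssgn, Bool.false_and, Bool.and_false, Bool.and_self, Bool.false_eq_true,
          if_false, if_true, one_smul, neg_smul]
        rw [← jacobi_even_odd_odd m k k' l u s t g q g' q']
        abel
      | odd k'' g'' q'' =>
        simp only [ssgn, Bool.and_self, if_true, neg_smul, one_smul]
        rw [← neg_eq_zero, ← jacobi_odd_odd_odd k k' k'' g q g' q' g'' q'']
        abel

theorem homog.bracket_skew {px py : Bool} {x y : V} (hx : homog px x) (hy : homog py y) :
    bracketHom x y = (-ssgn px py) • bracketHom y x := by
  refine homog_induction (P := fun x => bracketHom x y = (-ssgn px py) • bracketHom y x)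
    (by simp) (fun x x' h h' => ?_) (fun x hx => ?_) hx
  · simp only [map_add, LinearMap.add_apply, smul_add, h, h']
  refine homog_induction (P := fun y => bracketHom x y = (-ssgn px py) • bracketHom y x)
    (by simp) (fun y y' h h' => ?_) (fun y hy => hx.bracket_skew hy) hy
  simp only [map_add, LinearMap.add_apply, smul_add, h, h']

theorem homog.bracket_jacobi {px py pz : Bool} {x y z : V} (hx : homog px x) (hy : homog py y)
    (hz : homog pz z) :
    ssgn px pz • bracketHom (bracketHom x y) z + ssgn py px • bracketHom (bracketHom y z) x
      + ssgn pz py • bracketHom (bracketHom z x) y = 0 := by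
  refine homog_induction (P := fun x => ssgn px pz • bracketHom (bracketHom x y) z
      + ssgn py px • bracketHom (bracketHom y z) x
      + ssgn pz py • bracketHom (bracketHom z x) y = 0)
    (by simp) (fun x x' h h' => ?_) (fun x hx => ?_) hx
  · rw [← add_zero (0 : V)]
    nth_rw 1 [← h]
    rw [← h']
    simp only [map_add, LinearMap.add_apply, smul_add]
    abel
  refine homog_induction (P := fun y => ssgn px pz • bracketHom (bracketHom x y) z
      + ssgn py px • bracketHom (bracketHom y z) x
      + ssgn pz py • bracketHom (bracketHom z x) y = 0)
    (by simp) (fun y y' h h' => ?_) (fun y hy => ?_) hy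
  · rw [← add_zero (0 : V)]
    nth_rw 1 [← h]
    rw [← h']
    simp only [map_add, LinearMap.add_apply, smul_add]
    abel
  refine homog_induction (P := fun z => ssgn px pz • bracketHom (bracketHom x y) z
      + ssgn py px • bracketHom (bracketHom y z) x
      + ssgn pz py • bracketHom (bracketHom z x) y = 0)
    (by simp) (fun z z' h h' => ?_)
    (fun z hz => hx.bracket_jacobi hy hz) hz
  rw [← add_zero (0 : V)]
  nth_rw 1 [← h]
  rw [← h']
  simp only [map_add, LinearMap.add_apply, smul_add]
  abel

/-- The untwisted large `N = 4` bracket table defines a Lie superalgebra: it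
preserves the grading and, on homogeneous elements, satisfies super skew-symmetry
and the super Jacobi identity. -/
theorem centerless_large_N4_is_lie_superalgebra :
    (∀ a b : Gen, ∀ e ∈ (br a b).support, par e = xor (par a) (par b)) ∧
    (∀ (px py : Bool) (x y : V), homog px x → homog py y →
      bk x y = (-ssgn px py) • bk y x) ∧
    (∀ (px py pz : Bool) (x y z : V), homog px x → homog py y → homog pz z →
      ssgn px pz • bk (bk x y) z + ssgn py px • bk (bk y z) x
        + ssgn pz py • bk (bk z x) y = 0) := by
  refine ⟨fun a b e he => br_mem_supported a b he, fun px py x y hx hy => ?_,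
    fun px py pz x y z hx hy hz => ?_⟩
  · simpa only [bk_eq_bracketHom] using hx.bracket_skew hy
  · simpa only [bk_eq_bracketHom] using hx.bracket_jacobi hy hz

end LargeN4Untwisted

end
end

section
/- Let R be a commutative ℂ-algebra and let ν : M₂(ℂ) → M₂(R) be a ℂ-linear map such that for every traceless X ∈ M₂(ℂ) and every M ∈ M₂(ℂ): ν(X·M) = ι(X)·ν(M) and ν(M·X) = ν(M)·ι(X), where ι : M₂(ℂ) → M₂(R) is the entrywise structure map. Then there exists g ∈ R such that ν(M) = g · ι(M) for all M ∈ M₂(ℂ). -/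
open Matrix

/-- If a ℂ-linear map `ν : M₂(ℂ) → M₂(R)` intertwines left and right multiplication
by every traceless complex `2×2` matrix (through the entrywise structure map `ι`),
then `ν` is multiplication by a scalar `g ∈ R`. -/
theorem intertwiner_is_scalar (R : Type*) [CommRing R] [Algebra ℂ R]
    (ν : Matrix (Fin 2) (Fin 2) ℂ →ₗ[ℂ] Matrix (Fin 2) (Fin 2) R)
    (hLeft : ∀ X M : Matrix (Fin 2) (Fin 2) ℂ, X.trace = 0 →
      ν (X * M) = X.map (algebraMap ℂ R) * ν M)
    (hRight : ∀ X M : Matrix (Fin 2) (Fin 2) ℂ, X.trace = 0 →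
      ν (M * X) = ν M * X.map (algebraMap ℂ R)) :
    ∃ g : R, ∀ M : Matrix (Fin 2) (Fin 2) ℂ, ν M = g • M.map (algebraMap ℂ R) := by
  have hcomm : ∀ X : Matrix (Fin 2) (Fin 2) ℂ, X.trace = 0 →
      X.map (algebraMap ℂ R) * ν 1 = ν 1 * X.map (algebraMap ℂ R) := fun X hX => by
    rw [← hLeft X 1 hX, ← hRight X 1 hX, mul_one, one_mul]
  have hE := hcomm !![0, 1; 0, 0] (by simp [trace_fin_two])
  have hF := hcomm !![0, 0; 1, 0] (by simp [trace_fin_two])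
  have h10 : ν 1 1 0 = 0 := by
    simpa [Matrix.mul_apply, Fin.sum_univ_two] using congrFun₂ hE 0 0
  have h11 : ν 1 1 1 = ν 1 0 0 := by
    simpa [Matrix.mul_apply, Fin.sum_univ_two] using congrFun₂ hE 0 1
  have h01 : ν 1 0 1 = 0 := by
    simpa [Matrix.mul_apply, Fin.sum_univ_two] using (congrFun₂ hF 0 0).symm
  have hone : ν 1 = ν 1 0 0 • (1 : Matrix (Fin 2) (Fin 2) R) := by
    ext i j
    fin_cases i <;> fin_cases j <;> simp [h10, h11, h01]
  refine ⟨ν 1 0 0, fun M => ?_⟩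
  set c : ℂ := M.trace / 2
  have htr : (M - c • 1).trace = 0 := by
    simp [c, trace_sub, trace_smul]
  have hmap : (M - c • 1).map (algebraMap ℂ R) = M.map (algebraMap ℂ R) - c • 1 := by
    ext i j
    simp [Matrix.one_apply, Algebra.algebraMap_eq_smul_one, sub_smul]
  have hν := hLeft _ 1 htr
  rw [mul_one, map_sub, map_smul, hmap, sub_mul, smul_mul_assoc, one_mul,
    sub_left_inj] at hν
  rw [hν, hone]
  simp
end

section
/- Let R be an integral domain that is a ℂ-algebra, equipped with a derivation δ : R → R. Extend δ to the polynomial ring R[λ,μ] by δ(λ) = δ(μ) = 0, and let P be the additive operator on R[λ,μ] given by P(h) = (μ+λ)·h + δ(h). Suppose f₀, …, f_K ∈ R satisfy Σ_{m=0}^{K} Σ_{n=0}^{K} (−λ)^m · Pⁿ( (μ+2λ)·f_m·f_n + 2·δ(f_m)·f_n ) = 0 in R[λ,μ]. Then f_m = 0 for all m = 0, …, K. -/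
noncomputable section

/-- The coefficient-wise extension to `R[λ,μ]` of a map `δ : R → R`
(with `δ(λ) = δ(μ) = 0`); here `λ = X 0` and `μ = X 1`. -/
def extD {R : Type*} [CommRing R] (δ : R → R) (h : MvPolynomial (Fin 2) R) :
    MvPolynomial (Fin 2) R :=
  ∑ d ∈ h.support, MvPolynomial.monomial d (δ (h.coeff d))

/-- The operator `P(h) = (μ + λ)·h + δ(h)` on `R[λ,μ]`. -/
def Pop {R : Type*} [CommRing R] (δ : R → R) (h : MvPolynomial (Fin 2) R) :
    MvPolynomial (Fin 2) R :=
  (MvPolynomial.X 1 + MvPolynomial.X 0) * h + extD δ h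

theorem coeff_extD {R : Type*} [CommRing R] {δ : R → R} (hδ : δ 0 = 0)
    (p : MvPolynomial (Fin 2) R) (d : Fin 2 →₀ ℕ) :
    (extD δ p).coeff d = δ (p.coeff d) := by
  classical
  simp only [extD, MvPolynomial.coeff_sum, MvPolynomial.coeff_monomial, Finset.sum_ite_eq']
  split_ifs with hd
  · rfl
  · rw [MvPolynomial.notMem_support_iff.mp hd, hδ]

theorem coeff_Pop {R : Type*} [CommRing R] {δ : R → R} (hδ : δ 0 = 0)
    (p : MvPolynomial (Fin 2) R) (d : Fin 2 →₀ ℕ) :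
    (Pop δ p).coeff d =
      (if d 1 = 0 then 0 else p.coeff (d - Finsupp.single 1 1)) +
      (if d 0 = 0 then 0 else p.coeff (d - Finsupp.single 0 1)) + δ (p.coeff d) := by
  classical
  simp [Pop, coeff_extD hδ, add_mul, MvPolynomial.coeff_X_mul']

theorem totalDegree_Pop_le {R : Type*} [CommRing R] {δ : R → R} (hδ : δ 0 = 0)
    (p : MvPolynomial (Fin 2) R) : (Pop δ p).totalDegree ≤ p.totalDegree + 1 := by
  have hsub : (extD δ p).support ⊆ p.support := by
    intro d hd
    rw [MvPolynomial.mem_support_iff, coeff_extD hδ] at hd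
    rw [MvPolynomial.mem_support_iff]
    exact fun h0 => hd (by rw [h0, hδ])
  have hX : (MvPolynomial.X 1 + MvPolynomial.X 0 : MvPolynomial (Fin 2) R).totalDegree ≤ 1 :=
    (MvPolynomial.totalDegree_add _ _).trans <| max_le
      (MvPolynomial.totalDegree_monomial_le _ _ |>.trans (by simp))
      (MvPolynomial.totalDegree_monomial_le _ _ |>.trans (by simp))
  refine (MvPolynomial.totalDegree_add _ _).trans (max_le ?_ ?_)
  · have := MvPolynomial.totalDegree_mul (MvPolynomial.X 1 + MvPolynomial.X 0) p
    omega
  · exact (Finset.sup_mono hsub).trans (Nat.le_succ _)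

theorem totalDegree_iterate_Pop_le {R : Type*} [CommRing R] {δ : R → R} (hδ : δ 0 = 0)
    (p : MvPolynomial (Fin 2) R) (n : ℕ) :
    ((Pop δ)^[n] p).totalDegree ≤ p.totalDegree + n := by
  induction n with
  | zero => simp
  | succ n ih =>
    rw [Function.iterate_succ_apply']
    have := totalDegree_Pop_le hδ ((Pop δ)^[n] p)
    omega

theorem coeff_eq_zero_of_totalDegree_lt_add {R : Type*} [CommRing R]
    {p : MvPolynomial (Fin 2) R} {d : Fin 2 →₀ ℕ} (h : p.totalDegree < d 0 + d 1) :
    p.coeff d = 0 := by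
  by_contra hd
  have := MvPolynomial.le_totalDegree (MvPolynomial.mem_support_iff.mpr hd)
  rw [Finsupp.sum_fintype _ _ (fun _ => rfl), Fin.sum_univ_two] at this
  omega

theorem coeff_single_iterate_Pop {R : Type*} [CommRing R] {δ : R → R} (hδ : δ 0 = 0)
    {p : MvPolynomial (Fin 2) R} {k : ℕ} (hp : p.totalDegree ≤ k) (n : ℕ) :
    ((Pop δ)^[n] p).coeff (Finsupp.single 1 (k + n)) = p.coeff (Finsupp.single 1 k) := by
  induction n with
  | zero => simp
  | succ n ih =>
    have hdeg := totalDegree_iterate_Pop_le hδ p n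
    have hsub : (Finsupp.single 1 (k + (n + 1)) - Finsupp.single 1 1 : Fin 2 →₀ ℕ) =
        Finsupp.single 1 (k + n) := by
      rw [← Finsupp.single_tsub]; rfl
    have h0 : ((Pop δ)^[n] p).coeff (Finsupp.single 1 (k + (n + 1))) = 0 :=
      coeff_eq_zero_of_totalDegree_lt_add (by simp; omega)
    rw [Function.iterate_succ_apply', coeff_Pop hδ, hsub, ih, h0, hδ]
    simp

theorem coeff_neg_X_pow_mul {R : Type*} [CommRing R] (p : MvPolynomial (Fin 2) R)
    (m : ℕ) (d : Fin 2 →₀ ℕ) :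
    ((-(MvPolynomial.X 0 : MvPolynomial (Fin 2) R)) ^ m * p).coeff d =
      if m ≤ d 0 then (-1) ^ m * p.coeff (d - Finsupp.single 0 m) else 0 := by
  have hX : (-(MvPolynomial.X 0 : MvPolynomial (Fin 2) R)) ^ m =
      MvPolynomial.monomial (Finsupp.single 0 m) ((-1) ^ m) := by
    rw [neg_pow, MvPolynomial.X_pow_eq_monomial,
      show (-1 : MvPolynomial (Fin 2) R) = MvPolynomial.C (-1) by simp, ← map_pow,
      MvPolynomial.C_mul_monomial, mul_one]
  rw [hX, MvPolynomial.coeff_monomial_mul']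
  simp only [Finsupp.single_le_iff]

theorem totalDegree_linear_le_one {R : Type*} [CommRing R] (a b : R) :
    ((MvPolynomial.X 1 + 2 * MvPolynomial.X 0) * MvPolynomial.C a + MvPolynomial.C b :
      MvPolynomial (Fin 2) R).totalDegree ≤ 1 := by
  have hX (i : Fin 2) : (MvPolynomial.X i : MvPolynomial (Fin 2) R).totalDegree ≤ 1 :=
    MvPolynomial.totalDegree_monomial_le _ _ |>.trans (by simp)
  have h2 : (2 * MvPolynomial.X 0 : MvPolynomial (Fin 2) R).totalDegree ≤ 1 := by
    rw [two_mul]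
    exact (MvPolynomial.totalDegree_add _ _).trans (max_le (hX 0) (hX 0))
  refine (MvPolynomial.totalDegree_add _ _).trans (max_le ?_ (by simp))
  refine (MvPolynomial.totalDegree_mul _ _).trans ?_
  rw [MvPolynomial.totalDegree_C, add_zero]
  exact (MvPolynomial.totalDegree_add _ _).trans (max_le (hX 1) h2)

theorem coeff_single_one_linear {R : Type*} [CommRing R] (a b : R) :
    ((MvPolynomial.X 1 + 2 * MvPolynomial.X 0) * MvPolynomial.C a + MvPolynomial.C b :
      MvPolynomial (Fin 2) R).coeff (Finsupp.single 1 1) = a := by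
  classical
  have h01 : (Finsupp.single 0 1 : Fin 2 →₀ ℕ) ≠ Finsupp.single 1 1 := by
    intro h
    simpa using DFunLike.congr_fun h 0
  have h10 : (0 : Fin 2 →₀ ℕ) ≠ Finsupp.single 1 1 := by
    intro h
    simpa using DFunLike.congr_fun h 1
  rw [mul_comm _ (MvPolynomial.C a)]
  simp [two_mul, MvPolynomial.coeff_C_mul, MvPolynomial.coeff_X, MvPolynomial.coeff_C, h01, h10]

/-- If `Σ_{m,n=0}^{K} (−λ)^m · Pⁿ((μ+2λ)·f_m·f_n + 2·δ(f_m)·f_n) = 0` in `R[λ,μ]`,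
then all `f_m` vanish. -/
theorem coefficients_vanish (R : Type*) [CommRing R] [IsDomain R] [Algebra ℂ R]
    (δ : Derivation ℂ R R) (K : ℕ) (f : ℕ → R)
    (h : ∑ m ∈ Finset.range (K + 1), ∑ n ∈ Finset.range (K + 1),
        (-(MvPolynomial.X 0 : MvPolynomial (Fin 2) R)) ^ m *
          (Pop (⇑δ))^[n]
            ((MvPolynomial.X 1 + 2 * MvPolynomial.X 0) * MvPolynomial.C (f m * f n)
              + MvPolynomial.C (2 * (δ (f m) * f n))) = 0) :
    ∀ m ≤ K, f m = 0 := by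
  by_contra! hne
  obtain ⟨m₀, hm₀K, hm₀⟩ := hne
  classical
  obtain ⟨N, hN, hmax⟩ := ((Finset.range (K + 1)).filter (fun m => f m ≠ 0)).exists_max_image id
    ⟨m₀, by simp [hm₀]; omega⟩
  simp only [Finset.mem_filter, Finset.mem_range, id] at hN hmax
  have hδ : δ 0 = 0 := map_zero δ
  have hzero : ∀ m ∈ Finset.range (K + 1), N < m → f m = 0 := by
    intro m hm hlt
    by_contra hfm
    have := hmax m ⟨Finset.mem_range.mp hm, hfm⟩
    omega
  have hPzero (n : ℕ) : (Pop (⇑δ))^[n] 0 = 0 :=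
    Function.iterate_fixed (by simp [Pop, extD]) n
  have hc := congrArg (MvPolynomial.coeff (Finsupp.single 0 N + Finsupp.single 1 (N + 1))) h
  simp only [MvPolynomial.coeff_sum, coeff_neg_X_pow_mul, MvPolynomial.coeff_zero] at hc
  rw [Finset.sum_eq_single_of_mem N (Finset.mem_range.mpr hN.1),
    Finset.sum_eq_single_of_mem N (Finset.mem_range.mpr hN.1)] at hc
  · have htop := coeff_single_iterate_Pop hδ
      (totalDegree_linear_le_one (f N * f N) (2 * (δ (f N) * f N))) N
    rw [coeff_single_one_linear, add_comm 1 N] at htop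
    rw [add_tsub_cancel_left, htop] at hc
    simp [hN.2] at hc
  · intro n hn hnN
    rcases hnN.lt_or_gt with hlt | hgt
    · have hdeg := (totalDegree_iterate_Pop_le hδ _ n).trans
        (Nat.add_le_add_right
          (totalDegree_linear_le_one (f N * f n) (2 * (δ (f N) * f n))) n)
      rw [add_tsub_cancel_left, coeff_eq_zero_of_totalDegree_lt_add
        (hdeg.trans_lt (by simp; omega))]
      simp
    · simp [hzero n hn hgt, hPzero]
  · intro m hm hmN
    refine Finset.sum_eq_zero fun n hn => ?_
    rcases hmN.lt_or_gt with hlt | hgt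
    · rcases le_or_gt n N with hle | hgt
      · have hdeg := (totalDegree_iterate_Pop_le hδ _ n).trans
          (Nat.add_le_add_right
            (totalDegree_linear_le_one (f m * f n) (2 * (δ (f m) * f n))) n)
        rw [coeff_eq_zero_of_totalDegree_lt_add (hdeg.trans_lt (by simp; omega))]
        simp
      · simp [hzero n hn hgt, hPzero]
    · simp [hgt]

end
end

section
/- The twisted large N=4 bracket table defines a Lie superalgebra Alg(A,ω): on the ℤ/2-graded complex vector space with even basis {L_m, T^i_m : m ∈ ℤ, i = 1,2,3} ∪ {J^i_r, U_r : r ∈ ℤ+1/2, i = 1,2,3} and odd basis {Φ_m, Q^i_m : m ∈ ℤ, i = 1,2,3} ∪ {G^i_r, Ψ_r : r ∈ ℤ+1/2, i = 1,2,3}, the unique bilinear bracket determined by the twisted large N=4 bracket table satisfies super skew-symmetry and the super Jacobi identity. -/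
noncomputable section

namespace LargeN4Twisted

/-- The totally antisymmetric symbol on `Fin 3` with `ε_{123} = 1`. -/
def eps3 (i j k : Fin 3) : ℂ :=
  if (i, j, k) = (0, 1, 2) ∨ (i, j, k) = (1, 2, 0) ∨ (i, j, k) = (2, 0, 1) then 1
  else if (i, j, k) = (2, 1, 0) ∨ (i, j, k) = (1, 0, 2) ∨ (i, j, k) = (0, 2, 1) then -1
  else 0

/-- Basis of `Alg(A,ω)`: even generators `L_m, T^i_m` (`m ∈ ℤ`) and `J^i_r, U_r`
(`r ∈ ℤ + 1/2`); odd generators `Φ_m, Q^i_m` (`m ∈ ℤ`) and `G^i_r, Ψ_r`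
(`r ∈ ℤ + 1/2`).  Half-integer modes are encoded as `J i a ↦ J^i_{a+1/2}`,
`U a ↦ U_{a+1/2}`, `G i a ↦ G^i_{a+1/2}`, `Ps a ↦ Ψ_{a+1/2}`. -/
inductive Gen : Type
  | L : ℤ → Gen
  | T : Fin 3 → ℤ → Gen
  | J : Fin 3 → ℤ → Gen
  | U : ℤ → Gen
  | Ph : ℤ → Gen
  | Q : Fin 3 → ℤ → Gen
  | G : Fin 3 → ℤ → Gen
  | Ps : ℤ → Gen

/-- The underlying vector space: formal ℂ-linear combinations of generators. -/
abbrev V := Gen →₀ ℂ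

/-- A scalar multiple of a single basis vector. -/
def sgl (a : Gen) (c : ℂ) : V := Finsupp.single a c

/-- Kronecker delta. -/
def kdel (i j : Fin 3) : ℂ := if i = j then 1 else 0

/-- The twisted large `N = 4` bracket table on basis elements (reversed-order
brackets are the ones forced by super skew-symmetry; unlisted pairs are zero). -/
def br : Gen → Gen → V
  | .L m, .L n => sgl (.L (m + n)) ((m : ℂ) - n)
  | .L m, .U b => sgl (.U (m + b)) (-((b : ℂ) + 1/2))
  | .U b, .L m => sgl (.U (m + b)) ((b : ℂ) + 1/2)
  | .L m, .T i n => sgl (.T i (m + n)) (-(n : ℂ))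
  | .T i m, .L n => sgl (.T i (m + n)) (m : ℂ)
  | .L m, .J i b => sgl (.J i (m + b)) (-((b : ℂ) + 1/2))
  | .J i b, .L m => sgl (.J i (m + b)) ((b : ℂ) + 1/2)
  | .L m, .G i b => sgl (.G i (m + b)) ((m : ℂ) / 2 - b - 1/2)
  | .G i b, .L m => sgl (.G i (m + b)) ((b : ℂ) + 1/2 - (m : ℂ) / 2)
  | .L m, .Ph n => sgl (.Ph (m + n)) ((m : ℂ) / 2 - n)
  | .Ph n, .L m => sgl (.Ph (m + n)) ((n : ℂ) - (m : ℂ) / 2)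
  | .L m, .Q i n => sgl (.Q i (m + n)) (-((m : ℂ) / 2 + n))
  | .Q i n, .L m => sgl (.Q i (m + n)) ((m : ℂ) / 2 + n)
  | .L m, .Ps b => sgl (.Ps (m + b)) (-((m : ℂ) / 2 + b + 1/2))
  | .Ps b, .L m => sgl (.Ps (m + b)) ((m : ℂ) / 2 + b + 1/2)
  | .U a, .G i b => sgl (.Q i (a + b + 1)) ((a : ℂ) + 1/2)
  | .G i b, .U a => sgl (.Q i (a + b + 1)) (-((a : ℂ) + 1/2))
  | .U a, .Ph n => sgl (.Ps (a + n)) ((a : ℂ) + 1/2)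
  | .Ph n, .U a => sgl (.Ps (a + n)) (-((a : ℂ) + 1/2))
  | .T i m, .T j n => ∑ k : Fin 3, sgl (.T k (m + n)) (eps3 i j k)
  | .T i m, .J j b => ∑ k : Fin 3, sgl (.J k (m + b)) (eps3 i j k)
  | .J i b, .T j m => ∑ k : Fin 3, sgl (.J k (m + b)) (-eps3 j i k)
  | .T i m, .G j b =>
      (∑ k : Fin 3, sgl (.G k (m + b)) (eps3 i j k)) + sgl (.Ps (m + b)) (-(m : ℂ) * kdel i j)
  | .G i b, .T j m =>
      (∑ k : Fin 3, sgl (.G k (m + b)) (-eps3 j i k)) + sgl (.Ps (m + b)) ((m : ℂ) * kdel j i)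
  | .T i m, .Ph n => sgl (.Q i (m + n)) (m : ℂ)
  | .Ph n, .T i m => sgl (.Q i (m + n)) (-(m : ℂ))
  | .T i m, .Q j n => ∑ k : Fin 3, sgl (.Q k (m + n)) (eps3 i j k)
  | .Q i n, .T j m => ∑ k : Fin 3, sgl (.Q k (m + n)) (-eps3 j i k)
  | .J i a, .J j b => ∑ k : Fin 3, sgl (.T k (a + b + 1)) (eps3 i j k)
  | .J i a, .G j b => sgl (.Ph (a + b + 1)) (kdel i j)
      + ∑ k : Fin 3, sgl (.Q k (a + b + 1)) (-((a : ℂ) + 1/2) * eps3 i j k)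
  | .G i b, .J j a => sgl (.Ph (a + b + 1)) (-kdel j i)
      + ∑ k : Fin 3, sgl (.Q k (a + b + 1)) (((a : ℂ) + 1/2) * eps3 j i k)
  | .J i a, .Ph n => sgl (.G i (a + n)) (-1)
  | .Ph n, .J i a => sgl (.G i (a + n)) 1
  | .J i a, .Q j n => sgl (.Ps (a + n)) (kdel i j)
  | .Q i n, .J j a => sgl (.Ps (a + n)) (-kdel j i)
  | .J i a, .Ps b => sgl (.Q i (a + b + 1)) (-1)
  | .Ps b, .J i a => sgl (.Q i (a + b + 1)) 1
  | .G i a, .G j b => sgl (.L (a + b + 1)) (2 * kdel i j)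
      + ∑ k : Fin 3, sgl (.T k (a + b + 1)) (-((a : ℂ) - b) * eps3 i j k)
  | .G i a, .Ph n => sgl (.J i (a + n)) ((n : ℂ) - a - 1/2)
  | .Ph n, .G i a => sgl (.J i (a + n)) ((n : ℂ) - a - 1/2)
  | .Q i m, .G j b => sgl (.U (m + b)) (kdel i j)
      + ∑ k : Fin 3, sgl (.J k (m + b)) (eps3 i j k)
  | .G i b, .Q j m => sgl (.U (m + b)) (kdel j i)
      + ∑ k : Fin 3, sgl (.J k (m + b)) (eps3 j i k)
  | .Q i m, .Ph n => sgl (.T i (m + n)) 1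
  | .Ph n, .Q i m => sgl (.T i (m + n)) 1
  | .Ph m, .Ph n => sgl (.L (m + n)) 2
  | .Ps a, .G i b => sgl (.T i (a + b + 1)) (-1)
  | .G i b, .Ps a => sgl (.T i (a + b + 1)) (-1)
  | .Ps a, .Ph n => sgl (.U (a + n)) 1
  | .Ph n, .Ps a => sgl (.U (a + n)) 1
  | _, _ => 0

/-- The bilinear extension of the bracket to the whole space. -/
def bk (x y : V) : V :=
  x.sum fun a ca => y.sum fun b cb => (ca * cb) • br a b

/-- Parity of a generator: `Φ, Q, G, Ψ` are odd, `L, T, J, U` are even. -/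
def par : Gen → Bool
  | .Ph _ => true
  | .Q _ _ => true
  | .G _ _ => true
  | .Ps _ => true
  | _ => false

/-- `x` is homogeneous of parity `p`. -/
def homog (p : Bool) (x : V) : Prop := ∀ a ∈ x.support, par a = p

/-- The sign `(−1)^{|x||y|}`. -/
def ssgn (p q : Bool) : ℂ := if p && q then -1 else 1

open scoped Matrix

/-- Coefficients of one mode, of fixed parity, in the fields `(L, U, T, J)` or `(Φ, Ψ, Q, G)`. -/
abbrev Half := ℂ × ℂ × (Fin 3 → ℂ) × (Fin 3 → ℂ)

/-- The bracket of two even elements, of modes `r` and `s`. -/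
def evenBr (r s : ℂ) (x y : Half) : Half :=
  let ⟨l, u, t, j⟩ := x
  let ⟨l', u', t', j'⟩ := y
  ((r - s) * (l * l'),
    r * (u * l') - s * (l * u'),
    (r * l') • t - (s * l) • t' + t ⨯₃ t' + j ⨯₃ j',
    (r * l') • j - (s * l) • j' + t ⨯₃ j' - t' ⨯₃ j)

/-- The bracket of an even element of mode `r` with an odd element of mode `s`. -/
def mixedBr (r s : ℂ) (x y : Half) : Half :=
  let ⟨l, u, t, j⟩ := x
  let ⟨φ, ψ, q, g⟩ := y
  ((r / 2 - s) * (l * φ) + j ⬝ᵥ g,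
    -(r / 2 + s) * (l * ψ) + r * (u * φ) - r * (t ⬝ᵥ g) + j ⬝ᵥ q,
    (-(r / 2 + s) * l) • q + (r * u) • g + (r * φ) • t + t ⨯₃ q - r • (j ⨯₃ g) - ψ • j,
    ((r / 2 - s) * l) • g + t ⨯₃ g - φ • j)

/-- The bracket of two odd elements, of modes `r` and `s`. -/
def oddBr (r s : ℂ) (x y : Half) : Half :=
  let ⟨φ, ψ, q, g⟩ := x
  let ⟨φ', ψ', q', g'⟩ := y
  (2 * (g ⬝ᵥ g') + 2 * (φ * φ'),
    q ⬝ᵥ g' + q' ⬝ᵥ g + ψ * φ' + φ * ψ',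
    (s - r) • (g ⨯₃ g') + φ' • q + φ • q' - ψ • g' - ψ' • g,
    ((s - r) * φ') • g + ((r - s) * φ) • g' + q ⨯₃ g' + q' ⨯₃ g)

theorem Half.ext {x y : Half} (h₁ : x.1 = y.1) (h₂ : x.2.1 = y.2.1)
    (h₃ : x.2.2.1 0 = y.2.2.1 0) (h₄ : x.2.2.1 1 = y.2.2.1 1) (h₅ : x.2.2.1 2 = y.2.2.1 2)
    (h₆ : x.2.2.2 0 = y.2.2.2 0) (h₇ : x.2.2.2 1 = y.2.2.2 1) (h₈ : x.2.2.2 2 = y.2.2.2 2) :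
    x = y := by
  refine Prod.ext h₁ (Prod.ext h₂ (Prod.ext (funext fun k => ?_) (funext fun k => ?_))) <;>
    fin_cases k <;> assumption

theorem cross_zero (v w : Fin 3 → ℂ) : (v ⨯₃ w) 0 = v 1 * w 2 - v 2 * w 1 := by
  simp [cross_apply]

theorem cross_one (v w : Fin 3 → ℂ) : (v ⨯₃ w) 1 = v 2 * w 0 - v 0 * w 2 := by
  simp [cross_apply]

theorem cross_two (v w : Fin 3 → ℂ) : (v ⨯₃ w) 2 = v 0 * w 1 - v 1 * w 0 := by
  simp [cross_apply]

theorem evenBr_jacobi (r s t : ℂ) (x y z : Half) :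
    evenBr (r + s) t (evenBr r s x y) z + evenBr (s + t) r (evenBr s t y z) x
      + evenBr (t + r) s (evenBr t r z x) y = 0 := by
  apply Half.ext
  all_goals
    simp only [evenBr, cross_zero, cross_one, cross_two, Prod.fst_add, Prod.snd_add, Prod.fst_zero,
      Prod.snd_zero, Pi.add_apply, Pi.sub_apply, Pi.smul_apply, Pi.zero_apply, smul_eq_mul]
    ring

theorem mixedBr_evenBr (r s t : ℂ) (x y z : Half) :
    mixedBr (r + s) t (evenBr r s x y) z
      = mixedBr r (s + t) x (mixedBr s t y z) - mixedBr s (t + r) y (mixedBr r t x z) := by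
  apply Half.ext
  all_goals
    simp only [evenBr, mixedBr, cross_zero, cross_one, cross_two, Matrix.vec3_dotProduct,
      Prod.fst_sub, Prod.snd_sub, Pi.add_apply, Pi.sub_apply, Pi.smul_apply, smul_eq_mul]
    ring

theorem evenBr_oddBr (r s t : ℂ) (x y z : Half) :
    evenBr (s + t) r (oddBr s t y z) x
      + oddBr (r + s) t (mixedBr r s x y) z + oddBr (t + r) s (mixedBr r t x z) y = 0 := by
  apply Half.ext
  all_goals
    simp only [evenBr, mixedBr, oddBr, cross_zero, cross_one, cross_two, Matrix.vec3_dotProduct,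
      Prod.fst_add, Prod.snd_add, Prod.fst_zero, Prod.snd_zero, Pi.add_apply, Pi.sub_apply,
      Pi.smul_apply, Pi.zero_apply, smul_eq_mul]
    ring

theorem mixedBr_oddBr (r s t : ℂ) (x y z : Half) :
    mixedBr (r + s) t (oddBr r s x y) z + mixedBr (s + t) r (oddBr s t y z) x
      + mixedBr (t + r) s (oddBr t r z x) y = 0 := by
  apply Half.ext
  all_goals
    simp only [mixedBr, oddBr, cross_zero, cross_one, cross_two, Matrix.vec3_dotProduct,
      Prod.fst_add, Prod.snd_add, Prod.fst_zero, Prod.snd_zero, Pi.add_apply, Pi.sub_apply,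
      Pi.smul_apply, Pi.zero_apply, smul_eq_mul]
    ring

theorem evenBr_swap (r s : ℂ) (x y : Half) : evenBr r s x y = -evenBr s r y x := by
  apply Half.ext
  all_goals
    simp only [evenBr, cross_zero, cross_one, cross_two, Prod.fst_neg, Prod.snd_neg, Pi.neg_apply,
      Pi.add_apply, Pi.sub_apply, Pi.smul_apply, smul_eq_mul]
    ring

theorem oddBr_swap (r s : ℂ) (x y : Half) : oddBr r s x y = oddBr s r y x := by
  apply Half.ext
  all_goals
    simp only [oddBr, cross_zero, cross_one, cross_two, Matrix.vec3_dotProduct, Pi.add_apply,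
      Pi.sub_apply, Pi.smul_apply, smul_eq_mul]
    ring

/-- The bracket with a fixed even element on the right. -/
def evenBrRight (r s : ℂ) (y : Half) : Half →ₗ[ℂ] Half where
  toFun x := evenBr r s x y
  map_add' x x' := by apply Half.ext <;> simp [evenBr] <;> ring
  map_smul' c x := by apply Half.ext <;> simp [evenBr] <;> ring

/-- The bracket of even elements with a fixed odd element on the right. -/
def mixedBrRight (r s : ℂ) (y : Half) : Half →ₗ[ℂ] Half where
  toFun x := mixedBr r s x y
  map_add' x x' := by apply Half.ext <;> simp [mixedBr] <;> ring
  map_smul' c x := by apply Half.ext <;> simp [mixedBr] <;> ring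

/-- The bracket of odd elements with a fixed even element on the left. -/
def mixedBrLeft (r s : ℂ) (x : Half) : Half →ₗ[ℂ] Half where
  toFun y := mixedBr r s x y
  map_add' y y' := by apply Half.ext <;> simp [mixedBr] <;> ring
  map_smul' c y := by apply Half.ext <;> simp [mixedBr] <;> ring

/-- The bracket with a fixed odd element on the right. -/
def oddBrRight (r s : ℂ) (y : Half) : Half →ₗ[ℂ] Half where
  toFun x := oddBr r s x y
  map_add' x x' := by apply Half.ext <;> simp [oddBr] <;> ring
  map_smul' c x := by apply Half.ext <;> simp [oddBr] <;> ring

/-- Coefficients of one mode in all sixteen fields, even part first. -/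
abbrev Fiber := Half × Half

/-- The bracket of an arbitrary element of mode `r` with a fixed element `y` of mode `s`. -/
def fiberBr (r s : ℂ) (y : Fiber) : Fiber →ₗ[ℂ] Fiber :=
  (evenBrRight r s y.1 ∘ₗ .fst ℂ Half Half + oddBrRight r s y.2 ∘ₗ .snd ℂ Half Half).prod
    (mixedBrRight r s y.2 ∘ₗ .fst ℂ Half Half - mixedBrLeft s r y.1 ∘ₗ .snd ℂ Half Half)

theorem fiberBr_apply (r s : ℂ) (x y : Fiber) :
    fiberBr r s y x = (evenBr r s x.1 y.1 + oddBr r s x.2 y.2,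
      mixedBr r s x.1 y.2 - mixedBr s r y.1 x.2) := rfl

/-- The mode of a generator, in `ℤ` or `ℤ + 1/2`. -/
def mode : Gen → ℂ
  | .L m | .T _ m | .Ph m | .Q _ m => m
  | .J _ a | .U a | .G _ a | .Ps a => a + 1 / 2

/-- The field to which a generator belongs, as a basis vector of `Fiber`. -/
def vec : Gen → Fiber
  | .L _ => ((1, 0, 0, 0), 0)
  | .U _ => ((0, 1, 0, 0), 0)
  | .T i _ => ((0, 0, Pi.single i 1, 0), 0)
  | .J i _ => ((0, 0, 0, Pi.single i 1), 0)
  | .Ph _ => (0, (1, 0, 0, 0))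
  | .Ps _ => (0, (0, 1, 0, 0))
  | .Q i _ => (0, (0, 0, Pi.single i 1, 0))
  | .G i _ => (0, (0, 0, 0, Pi.single i 1))

/-- The embedding of `V` in the space of finite sums of modes of the sixteen fields. -/
def toModes : V →ₗ[ℂ] ℂ →₀ Fiber :=
  Finsupp.linearCombination ℂ fun a => Finsupp.single (mode a) (vec a)

theorem toModes_sgl {a : Gen} (r : ℂ) (h : mode a = r) (c : ℂ) :
    toModes (sgl a c) = Finsupp.lsingle (R := ℂ) r (c • vec a) := by
  simp [toModes, sgl, h]

/-- The coefficient of a generator in an element of the image of `toModes`. -/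
def coeff : Gen → (ℂ →₀ Fiber) → ℂ
  | .L m, w => (w m).1.1
  | .U a, w => (w (a + 1 / 2)).1.2.1
  | .T i m, w => (w m).1.2.2.1 i
  | .J i a, w => (w (a + 1 / 2)).1.2.2.2 i
  | .Ph m, w => (w m).2.1
  | .Ps a, w => (w (a + 1 / 2)).2.2.1
  | .Q i m, w => (w m).2.2.2.1 i
  | .G i a, w => (w (a + 1 / 2)).2.2.2.2 i

theorem coeff_toModes (a : Gen) (v : V) : coeff a (toModes v) = v a := by
  classical
  induction v using Finsupp.induction_linear with
  | zero => cases a <;> simp [coeff]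
  | add v w hv hw =>
    rw [map_add, Finsupp.add_apply, ← hv, ← hw]
    cases a <;> simp [coeff]
  | single b c =>
    cases a <;> cases b <;>
      simp [coeff, toModes, mode, vec, Finsupp.single_apply] <;>
      split_ifs <;> simp_all [eq_comm]

theorem toModes_injective : Function.Injective toModes := fun v w h =>
  Finsupp.ext fun a => by rw [← coeff_toModes, h, coeff_toModes]

theorem single_cross_single (i j : Fin 3) :
    (Pi.single i 1 : Fin 3 → ℂ) ⨯₃ Pi.single j 1 = eps3 i j := by
  ext k
  fin_cases i <;> fin_cases j <;> fin_cases k <;> simp [cross_apply, eps3]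

theorem single_dotProduct_single_eq_kdel (i j : Fin 3) :
    (Pi.single i 1 : Fin 3 → ℂ) ⬝ᵥ Pi.single j 1 = kdel i j := by
  simp [kdel, Pi.single_apply, eq_comm]

theorem sum_smul_vec_T (f : Fin 3 → ℂ) (m : ℤ) :
    ∑ k, f k • vec (.T k m) = ((0, 0, f, 0), 0) := by
  apply Prod.ext <;> apply Half.ext <;> simp [vec, Fin.sum_univ_three]

theorem sum_smul_vec_J (f : Fin 3 → ℂ) (a : ℤ) :
    ∑ k, f k • vec (.J k a) = ((0, 0, 0, f), 0) := by
  apply Prod.ext <;> apply Half.ext <;> simp [vec, Fin.sum_univ_three]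

theorem sum_smul_vec_Q (f : Fin 3 → ℂ) (m : ℤ) :
    ∑ k, f k • vec (.Q k m) = (0, (0, 0, f, 0)) := by
  apply Prod.ext <;> apply Half.ext <;> simp [vec, Fin.sum_univ_three]

theorem sum_smul_vec_G (f : Fin 3 → ℂ) (a : ℤ) :
    ∑ k, f k • vec (.G k a) = (0, (0, 0, 0, f)) := by
  apply Prod.ext <;> apply Half.ext <;> simp [vec, Fin.sum_univ_three]

set_option maxHeartbeats 4000000 in
theorem toModes_br (a b : Gen) :
    toModes (br a b)
      = Finsupp.single (mode a + mode b) (fiberBr (mode a) (mode b) (vec b) (vec a)) := by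
  rw [← Finsupp.lsingle_apply (R := ℂ)]
  obtain ⟨r, hr⟩ : ∃ r, r = mode a + mode b := ⟨_, rfl⟩
  rw [← hr]
  cases a <;> cases b <;> simp only [br]
  all_goals
    first
    | refine (map_zero toModes).trans
        ((map_zero (Finsupp.lsingle (R := ℂ) (M := Fiber) r)).symm.trans (congrArg _ ?_))
    | simp (disch := rw [hr]; simp only [mode]; push_cast; ring1) only
        [map_add, map_sum, toModes_sgl r]
      try simp only [← map_add, ← map_sum]
      refine congrArg _ ?_
    try simp only [sum_smul_vec_T, sum_smul_vec_J, sum_smul_vec_Q, sum_smul_vec_G]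
    try simp [mode, vec, fiberBr_apply, evenBr, mixedBr, oddBr, single_cross_single,
        single_dotProduct_single_eq_kdel, -dotProduct_single, -single_dotProduct,
        Prod.ext_iff]
    try first
      | rfl
      | ring1
      | module
      | funext k
        simp only [Pi.neg_apply, Pi.smul_apply, smul_eq_mul]
        ring1

/-- The bracket `bk` as a bilinear map. -/
def bracket : V →ₗ[ℂ] V →ₗ[ℂ] V :=
  Finsupp.lsum ℂ fun a => LinearMap.toSpanSingleton ℂ _ (Finsupp.linearCombination ℂ (br a))

theorem bk_eq_bracket (x y : V) : bk x y = bracket x y := by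
  simp [bk, bracket, Finsupp.linearCombination_apply, Finsupp.lsum_apply, Finsupp.sum,
    LinearMap.sum_apply, Finset.smul_sum, mul_smul]

theorem bracket_single_single (a b : Gen) (c d : ℂ) :
    bracket (Finsupp.single a c) (Finsupp.single b d) = (c * d) • br a b := by
  simp [bracket, mul_smul]

/-- The element of `Fiber` of parity `p` with given coefficients. -/
def ofParity : Bool → Half → Fiber
  | false, x => (x, 0)
  | true, x => (0, x)

theorem vec_eq_ofParity (a : Gen) : ∃ x, vec a = ofParity (par a) x := by
  cases a <;> exact ⟨_, rfl⟩

@[simp] theorem evenBr_zero_left (r s : ℂ) (y : Half) : evenBr r s 0 y = 0 :=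
  map_zero (evenBrRight r s y)

@[simp] theorem mixedBr_zero_left (r s : ℂ) (y : Half) : mixedBr r s 0 y = 0 :=
  map_zero (mixedBrRight r s y)

@[simp] theorem mixedBr_zero_right (r s : ℂ) (x : Half) : mixedBr r s x 0 = 0 :=
  map_zero (mixedBrLeft r s x)

@[simp] theorem mixedBr_neg_right (r s : ℂ) (x y : Half) :
    mixedBr r s x (-y) = -mixedBr r s x y :=
  map_neg (mixedBrLeft r s x) y

@[simp] theorem oddBr_zero_left (r s : ℂ) (y : Half) : oddBr r s 0 y = 0 :=
  map_zero (oddBrRight r s y)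

@[simp] theorem oddBr_neg_left (r s : ℂ) (x y : Half) : oddBr r s (-x) y = -oddBr r s x y :=
  map_neg (oddBrRight r s y) x

@[simp] theorem evenBr_zero_right (r s : ℂ) (x : Half) : evenBr r s x 0 = 0 := by
  rw [evenBr_swap, evenBr_zero_left, neg_zero]

@[simp] theorem oddBr_zero_right (r s : ℂ) (x : Half) : oddBr r s x 0 = 0 := by
  rw [oddBr_swap, oddBr_zero_left]

theorem fiberBr_skew (p q : Bool) (r s : ℂ) (x y : Half) :
    fiberBr r s (ofParity q y) (ofParity p x)
      = (-ssgn p q) • fiberBr s r (ofParity p x) (ofParity q y) := by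
  cases p <;> cases q <;> simp [ofParity, fiberBr_apply, ssgn]
  · exact evenBr_swap ..
  · exact oddBr_swap ..

theorem fiberBr_jacobi (p q l : Bool) (r s t : ℂ) (x y z : Half) :
    ssgn p l • fiberBr (r + s) t (ofParity l z) (fiberBr r s (ofParity q y) (ofParity p x))
      + ssgn q p • fiberBr (s + t) r (ofParity p x) (fiberBr s t (ofParity l z) (ofParity q y))
      + ssgn l q • fiberBr (t + r) s (ofParity q y) (fiberBr t r (ofParity p x) (ofParity l z))
      = 0 := by
  cases p <;> cases q <;> cases l <;> simp [ofParity, fiberBr_apply, ssgn]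
  · exact evenBr_jacobi ..
  · linear_combination mixedBr_evenBr r s t x y z
  · linear_combination mixedBr_evenBr t r s z x y
  · linear_combination evenBr_oddBr r s t x y z
  · linear_combination mixedBr_evenBr s t r y z x
  · linear_combination evenBr_oddBr s t r y z x
  · linear_combination evenBr_oddBr t r s z x y
  · linear_combination -mixedBr_oddBr r s t x y z

/-- The bracket with a fixed element `y` of mode `s`. -/
def modesBr (s : ℂ) (y : Fiber) : (ℂ →₀ Fiber) →ₗ[ℂ] ℂ →₀ Fiber :=
  Finsupp.lsum ℂ fun r => Finsupp.lsingle (r + s) ∘ₗ fiberBr r s y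

theorem modesBr_single (r s : ℂ) (x y : Fiber) :
    modesBr s y (Finsupp.single r x) = Finsupp.single (r + s) (fiberBr r s y x) := by
  simp [modesBr]

theorem toModes_bracket_single (v : V) (b : Gen) :
    toModes (bracket v (Finsupp.single b 1)) = modesBr (mode b) (vec b) (toModes v) := by
  induction v using Finsupp.induction_linear with
  | zero => simp
  | add v w hv hw => simp [hv, hw]
  | single a c =>
    rw [bracket_single_single, mul_one, map_smul, toModes_br, ← modesBr_single, ← map_smul]
    simp [toModes]

theorem toModes_bracket_br (a b c : Gen) :
    toModes (bracket (br a b) (Finsupp.single c 1))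
      = Finsupp.single (mode a + mode b + mode c)
        (fiberBr (mode a + mode b) (mode c) (vec c)
          (fiberBr (mode a) (mode b) (vec b) (vec a))) := by
  rw [toModes_bracket_single, toModes_br, modesBr_single]

theorem br_skew (a b : Gen) : br a b = (-ssgn (par a) (par b)) • br b a := by
  apply toModes_injective
  obtain ⟨x, hx⟩ := vec_eq_ofParity a
  obtain ⟨y, hy⟩ := vec_eq_ofParity b
  rw [map_smul, toModes_br, toModes_br, hx, hy, fiberBr_skew, add_comm (mode b),
    Finsupp.smul_single]

theorem br_jacobi (a b c : Gen) :
    ssgn (par a) (par c) • bracket (br a b) (Finsupp.single c 1)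
      + ssgn (par b) (par a) • bracket (br b c) (Finsupp.single a 1)
      + ssgn (par c) (par b) • bracket (br c a) (Finsupp.single b 1) = 0 := by
  apply toModes_injective
  obtain ⟨x, hx⟩ := vec_eq_ofParity a
  obtain ⟨y, hy⟩ := vec_eq_ofParity b
  obtain ⟨z, hz⟩ := vec_eq_ofParity c
  simp only [map_add, map_smul, map_zero, toModes_bracket_br, Finsupp.smul_single]
  rw [← add_rotate (mode b), ← add_rotate (mode a), ← Finsupp.single_add, ← Finsupp.single_add,
    hx, hy, hz, fiberBr_jacobi, Finsupp.single_zero]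

theorem homog.mem_span {p : Bool} {x : V} (hx : homog p x) :
    x ∈ Submodule.span ℂ ((fun a => Finsupp.single a 1) '' {a | par a = p}) := by
  rw [← Finsupp.supported_eq_span_single]
  exact hx

theorem bracket_skew {p q : Bool} {x y : V} (hx : homog p x) (hy : homog q y) :
    bracket x y = (-ssgn p q) • bracket y x := by
  replace hx := hx.mem_span
  replace hy := hy.mem_span
  induction hx using Submodule.span_induction with
  | zero => simp
  | add x x' _ _ h h' => simp only [map_add, LinearMap.add_apply, h, h', smul_add]
  | smul c x _ h => simp only [map_smul, LinearMap.smul_apply, h, smul_comm c]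
  | mem _ h =>
    obtain ⟨a, ha, rfl⟩ := h
    induction hy using Submodule.span_induction with
    | zero => simp
    | add y y' _ _ h h' => simp only [map_add, LinearMap.add_apply, h, h', smul_add]
    | smul c y _ h => simp only [map_smul, LinearMap.smul_apply, h, smul_comm c]
    | mem _ h =>
      obtain ⟨b, hb, rfl⟩ := h
      subst ha hb
      simp only [bracket_single_single, mul_one, one_smul]
      exact br_skew a b

theorem bracket_jacobi {p q l : Bool} {x y z : V} (hx : homog p x) (hy : homog q y)
    (hz : homog l z) :
    ssgn p l • bracket (bracket x y) z + ssgn q p • bracket (bracket y z) x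
      + ssgn l q • bracket (bracket z x) y = 0 := by
  replace hx := hx.mem_span
  replace hy := hy.mem_span
  replace hz := hz.mem_span
  induction hx using Submodule.span_induction with
  | zero => simp
  | add x x' _ _ h h' =>
    simp only [map_add, LinearMap.add_apply]
    linear_combination (norm := module) h + h'
  | smul c x _ h =>
    simp only [map_smul, LinearMap.smul_apply]
    linear_combination (norm := module) c • h
  | mem _ h =>
    obtain ⟨a, ha, rfl⟩ := h
    induction hy using Submodule.span_induction with
    | zero => simp
    | add y y' _ _ h h' =>
      simp only [map_add, LinearMap.add_apply]
      linear_combination (norm := module) h + h'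
    | smul c y _ h =>
      simp only [map_smul, LinearMap.smul_apply]
      linear_combination (norm := module) c • h
    | mem _ h =>
      obtain ⟨b, hb, rfl⟩ := h
      induction hz using Submodule.span_induction with
      | zero => simp
      | add z z' _ _ h h' =>
        simp only [map_add, LinearMap.add_apply]
        linear_combination (norm := module) h + h'
      | smul c z _ h =>
        simp only [map_smul, LinearMap.smul_apply]
        linear_combination (norm := module) c • h
      | mem _ h =>
        obtain ⟨c, hc, rfl⟩ := h
        subst ha hb hc
        simp only [bracket_single_single, mul_one, one_smul]
        exact br_jacobi a b c

theorem sgl_mem_supported {s : Set Gen} {a : Gen} (h : a ∈ s) (c : ℂ) :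
    sgl a c ∈ Finsupp.supported ℂ ℂ s :=
  Finsupp.single_mem_supported ℂ c h

theorem br_mem_supported (a b : Gen) :
    br a b ∈ Finsupp.supported ℂ ℂ {e | par e = xor (par a) (par b)} := by
  cases a <;> cases b <;> simp only [br]
  all_goals repeat' first
    | exact zero_mem _
    | exact sgl_mem_supported (by rfl) _
    | refine sum_mem fun _ _ => ?_
    | refine add_mem ?_ ?_

/-- The twisted large `N = 4` bracket table defines a Lie superalgebra `Alg(A,ω)`:
it preserves the grading and, on homogeneous elements, satisfies super
skew-symmetry and the super Jacobi identity. -/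
theorem twisted_large_N4_is_lie_superalgebra :
    (∀ a b : Gen, ∀ e ∈ (br a b).support, par e = xor (par a) (par b)) ∧
    (∀ (px py : Bool) (x y : V), homog px x → homog py y →
      bk x y = (-ssgn px py) • bk y x) ∧
    (∀ (px py pz : Bool) (x y z : V), homog px x → homog py y → homog pz z →
      ssgn px pz • bk (bk x y) z + ssgn py px • bk (bk y z) x
        + ssgn pz py • bk (bk z x) y = 0) := by
  simp only [bk_eq_bracket]
  exact ⟨fun a b _ he => br_mem_supported a b he, fun _ _ _ _ => bracket_skew,
    fun _ _ _ _ _ _ => bracket_jacobi⟩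

end LargeN4Twisted

end
end

section
/- The centerless large N=4 superconformal algebra g (given by the untwisted large N=4 bracket table) and the twisted superconformal algebra Alg(A,ω) (given by the twisted large N=4 bracket table) are not isomorphic as Lie superalgebras: there is no parity-preserving ℂ-linear bijection Θ between the two underlying ℤ/2-graded vector spaces satisfying Θ([x,y]) = [Θ(x),Θ(y)] for all x, y. -/
noncomputable section

namespace LargeN4

/-- The totally antisymmetric symbol on `Fin 3` with `ε_{123} = 1`. -/
def eps3 (i j k : Fin 3) : ℂ :=
  if (i, j, k) = (0, 1, 2) ∨ (i, j, k) = (1, 2, 0) ∨ (i, j, k) = (2, 0, 1) then 1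
  else if (i, j, k) = (2, 1, 0) ∨ (i, j, k) = (1, 0, 2) ∨ (i, j, k) = (0, 2, 1) then -1
  else 0

/-- The antisymmetric symbol with indices in `Fin 4`, `0` if any index is `4` (i.e. `3`). -/
def eps4 (i : Fin 3) (p q : Fin 4) : ℂ :=
  if hp : (p : ℕ) < 3 then
    if hq : (q : ℕ) < 3 then eps3 i ⟨p, hp⟩ ⟨q, hq⟩ else 0
  else 0

/-- `α^{+i}_{pq} = (1/2)(δ_{ip}δ_{4q} − δ_{iq}δ_{4p}) + (1/2)ε_{ipq}`. -/
def alP (i : Fin 3) (p q : Fin 4) : ℂ :=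
  (1 / 2) * ((if (p : ℕ) = (i : ℕ) then 1 else 0) * (if q = 3 then 1 else 0)
    - (if (q : ℕ) = (i : ℕ) then 1 else 0) * (if p = 3 then 1 else 0))
  + (1 / 2) * eps4 i p q

/-- `α^{−i}_{pq} = −(1/2)(δ_{ip}δ_{4q} − δ_{iq}δ_{4p}) + (1/2)ε_{ipq}`. -/
def alM (i : Fin 3) (p q : Fin 4) : ℂ :=
  -(1 / 2) * ((if (p : ℕ) = (i : ℕ) then 1 else 0) * (if q = 3 then 1 else 0)
    - (if (q : ℕ) = (i : ℕ) then 1 else 0) * (if p = 3 then 1 else 0))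
  + (1 / 2) * eps4 i p q

namespace UA
/-! The untwisted (centerless) large `N = 4` superconformal algebra `g`. -/

/-- Basis: even `L_m, U_m, T^{±i}_m` (`m ∈ ℤ`); odd `G^p_s, Q^p_s`
(`s ∈ ℤ + 1/2`, encoded as `G p k ↦ G^p_{k+1/2}`, `Q p k ↦ Q^p_{k+1/2}`). -/
inductive Gen : Type
  | L : ℤ → Gen
  | U : ℤ → Gen
  | Tp : Fin 3 → ℤ → Gen
  | Tm : Fin 3 → ℤ → Gen
  | G : Fin 4 → ℤ → Gen
  | Q : Fin 4 → ℤ → Gen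

abbrev V := Gen →₀ ℂ

def sgl (a : Gen) (c : ℂ) : V := Finsupp.single a c

def kdel {n : ℕ} (i j : Fin n) : ℂ := if i = j then 1 else 0

/-- The untwisted large `N = 4` bracket table on basis elements. -/
def br : Gen → Gen → V
  | .L m, .L n => sgl (.L (m + n)) ((m : ℂ) - n)
  | .L m, .U n => sgl (.U (m + n)) (-(n : ℂ))
  | .U m, .L n => sgl (.U (m + n)) (m : ℂ)
  | .L m, .Tp i n => sgl (.Tp i (m + n)) (-(n : ℂ))
  | .Tp i m, .L n => sgl (.Tp i (m + n)) (m : ℂ)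
  | .L m, .Tm i n => sgl (.Tm i (m + n)) (-(n : ℂ))
  | .Tm i m, .L n => sgl (.Tm i (m + n)) (m : ℂ)
  | .L m, .G p k => sgl (.G p (m + k)) ((m : ℂ) / 2 - k - 1/2)
  | .G p k, .L m => sgl (.G p (m + k)) ((k : ℂ) + 1/2 - (m : ℂ) / 2)
  | .L m, .Q p k => sgl (.Q p (m + k)) (-((m : ℂ) / 2 + k + 1/2))
  | .Q p k, .L m => sgl (.Q p (m + k)) ((m : ℂ) / 2 + k + 1/2)
  | .U _, .U _ => 0
  | .U _, .Tp _ _ => 0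
  | .Tp _ _, .U _ => 0
  | .U _, .Tm _ _ => 0
  | .Tm _ _, .U _ => 0
  | .U m, .G p k => sgl (.Q p (m + k)) (m : ℂ)
  | .G p k, .U m => sgl (.Q p (m + k)) (-(m : ℂ))
  | .U _, .Q _ _ => 0
  | .Q _ _, .U _ => 0
  | .Tp i m, .Tp j n => ∑ k : Fin 3, sgl (.Tp k (m + n)) (eps3 i j k)
  | .Tm i m, .Tm j n => ∑ k : Fin 3, sgl (.Tm k (m + n)) (eps3 i j k)
  | .Tp _ _, .Tm _ _ => 0
  | .Tm _ _, .Tp _ _ => 0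
  | .Tp i m, .G p k =>
      ∑ q : Fin 4, (sgl (.G q (m + k)) (alP i p q) + sgl (.Q q (m + k)) (-(m : ℂ) * alP i p q))
  | .G p k, .Tp i m =>
      ∑ q : Fin 4, (sgl (.G q (m + k)) (-alP i p q) + sgl (.Q q (m + k)) ((m : ℂ) * alP i p q))
  | .Tm i m, .G p k =>
      ∑ q : Fin 4, (sgl (.G q (m + k)) (alM i p q) + sgl (.Q q (m + k)) ((m : ℂ) * alM i p q))
  | .G p k, .Tm i m =>
      ∑ q : Fin 4, (sgl (.G q (m + k)) (-alM i p q) + sgl (.Q q (m + k)) (-(m : ℂ) * alM i p q))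
  | .Tp i m, .Q p k => ∑ q : Fin 4, sgl (.Q q (m + k)) (alP i p q)
  | .Q p k, .Tp i m => ∑ q : Fin 4, sgl (.Q q (m + k)) (-alP i p q)
  | .Tm i m, .Q p k => ∑ q : Fin 4, sgl (.Q q (m + k)) (alM i p q)
  | .Q p k, .Tm i m => ∑ q : Fin 4, sgl (.Q q (m + k)) (-alM i p q)
  | .G p a, .G q b => sgl (.L (a + b + 1)) (2 * kdel p q)
      + ∑ i : Fin 3, (sgl (.Tp i (a + b + 1)) (2 * ((b : ℂ) - a) * alP i p q)
          + sgl (.Tm i (a + b + 1)) (2 * ((b : ℂ) - a) * alM i p q))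
  | .Q p a, .G q b => sgl (.U (a + b + 1)) (kdel p q)
      + ∑ i : Fin 3, (sgl (.Tp i (a + b + 1)) (2 * alP i p q)
          + sgl (.Tm i (a + b + 1)) (-2 * alM i p q))
  | .G p a, .Q q b => sgl (.U (a + b + 1)) (kdel q p)
      + ∑ i : Fin 3, (sgl (.Tp i (a + b + 1)) (2 * alP i q p)
          + sgl (.Tm i (a + b + 1)) (-2 * alM i q p))
  | .Q _ _, .Q _ _ => 0

/-- The bilinear extension of the bracket. -/
def bk (x y : V) : V :=
  x.sum fun a ca => y.sum fun b cb => (ca * cb) • br a b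

/-- Parity: `G` and `Q` are odd. -/
def par : Gen → Bool
  | .G _ _ => true
  | .Q _ _ => true
  | _ => false

/-- `x` is homogeneous of parity `p`. -/
def homog (p : Bool) (x : V) : Prop := ∀ a ∈ x.support, par a = p

end UA

namespace TW
/-! The twisted large `N = 4` superconformal algebra `Alg(A,ω)`. -/

/-- Basis: even `L_m, T^i_m` (`m ∈ ℤ`) and `J^i_r, U_r` (`r ∈ ℤ + 1/2`); odd
`Φ_m, Q^i_m` (`m ∈ ℤ`) and `G^i_r, Ψ_r` (`r ∈ ℤ + 1/2`).  Half-integer modes are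
encoded as `J i a ↦ J^i_{a+1/2}`, `U a ↦ U_{a+1/2}`, `G i a ↦ G^i_{a+1/2}`,
`Ps a ↦ Ψ_{a+1/2}`. -/
inductive Gen : Type
  | L : ℤ → Gen
  | T : Fin 3 → ℤ → Gen
  | J : Fin 3 → ℤ → Gen
  | U : ℤ → Gen
  | Ph : ℤ → Gen
  | Q : Fin 3 → ℤ → Gen
  | G : Fin 3 → ℤ → Gen
  | Ps : ℤ → Gen

abbrev V := Gen →₀ ℂ

def sgl (a : Gen) (c : ℂ) : V := Finsupp.single a c

def kdel (i j : Fin 3) : ℂ := if i = j then 1 else 0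

/-- The twisted large `N = 4` bracket table on basis elements (unlisted pairs are zero). -/
def br : Gen → Gen → V
  | .L m, .L n => sgl (.L (m + n)) ((m : ℂ) - n)
  | .L m, .U b => sgl (.U (m + b)) (-((b : ℂ) + 1/2))
  | .U b, .L m => sgl (.U (m + b)) ((b : ℂ) + 1/2)
  | .L m, .T i n => sgl (.T i (m + n)) (-(n : ℂ))
  | .T i m, .L n => sgl (.T i (m + n)) (m : ℂ)
  | .L m, .J i b => sgl (.J i (m + b)) (-((b : ℂ) + 1/2))
  | .J i b, .L m => sgl (.J i (m + b)) ((b : ℂ) + 1/2)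
  | .L m, .G i b => sgl (.G i (m + b)) ((m : ℂ) / 2 - b - 1/2)
  | .G i b, .L m => sgl (.G i (m + b)) ((b : ℂ) + 1/2 - (m : ℂ) / 2)
  | .L m, .Ph n => sgl (.Ph (m + n)) ((m : ℂ) / 2 - n)
  | .Ph n, .L m => sgl (.Ph (m + n)) ((n : ℂ) - (m : ℂ) / 2)
  | .L m, .Q i n => sgl (.Q i (m + n)) (-((m : ℂ) / 2 + n))
  | .Q i n, .L m => sgl (.Q i (m + n)) ((m : ℂ) / 2 + n)
  | .L m, .Ps b => sgl (.Ps (m + b)) (-((m : ℂ) / 2 + b + 1/2))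
  | .Ps b, .L m => sgl (.Ps (m + b)) ((m : ℂ) / 2 + b + 1/2)
  | .U a, .G i b => sgl (.Q i (a + b + 1)) ((a : ℂ) + 1/2)
  | .G i b, .U a => sgl (.Q i (a + b + 1)) (-((a : ℂ) + 1/2))
  | .U a, .Ph n => sgl (.Ps (a + n)) ((a : ℂ) + 1/2)
  | .Ph n, .U a => sgl (.Ps (a + n)) (-((a : ℂ) + 1/2))
  | .T i m, .T j n => ∑ k : Fin 3, sgl (.T k (m + n)) (eps3 i j k)
  | .T i m, .J j b => ∑ k : Fin 3, sgl (.J k (m + b)) (eps3 i j k)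
  | .J i b, .T j m => ∑ k : Fin 3, sgl (.J k (m + b)) (-eps3 j i k)
  | .T i m, .G j b =>
      (∑ k : Fin 3, sgl (.G k (m + b)) (eps3 i j k)) + sgl (.Ps (m + b)) (-(m : ℂ) * kdel i j)
  | .G i b, .T j m =>
      (∑ k : Fin 3, sgl (.G k (m + b)) (-eps3 j i k)) + sgl (.Ps (m + b)) ((m : ℂ) * kdel j i)
  | .T i m, .Ph n => sgl (.Q i (m + n)) (m : ℂ)
  | .Ph n, .T i m => sgl (.Q i (m + n)) (-(m : ℂ))
  | .T i m, .Q j n => ∑ k : Fin 3, sgl (.Q k (m + n)) (eps3 i j k)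
  | .Q i n, .T j m => ∑ k : Fin 3, sgl (.Q k (m + n)) (-eps3 j i k)
  | .J i a, .J j b => ∑ k : Fin 3, sgl (.T k (a + b + 1)) (eps3 i j k)
  | .J i a, .G j b => sgl (.Ph (a + b + 1)) (kdel i j)
      + ∑ k : Fin 3, sgl (.Q k (a + b + 1)) (-((a : ℂ) + 1/2) * eps3 i j k)
  | .G i b, .J j a => sgl (.Ph (a + b + 1)) (-kdel j i)
      + ∑ k : Fin 3, sgl (.Q k (a + b + 1)) (((a : ℂ) + 1/2) * eps3 j i k)
  | .J i a, .Ph n => sgl (.G i (a + n)) (-1)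
  | .Ph n, .J i a => sgl (.G i (a + n)) 1
  | .J i a, .Q j n => sgl (.Ps (a + n)) (kdel i j)
  | .Q i n, .J j a => sgl (.Ps (a + n)) (-kdel j i)
  | .J i a, .Ps b => sgl (.Q i (a + b + 1)) (-1)
  | .Ps b, .J i a => sgl (.Q i (a + b + 1)) 1
  | .G i a, .G j b => sgl (.L (a + b + 1)) (2 * kdel i j)
      + ∑ k : Fin 3, sgl (.T k (a + b + 1)) (-((a : ℂ) - b) * eps3 i j k)
  | .G i a, .Ph n => sgl (.J i (a + n)) ((n : ℂ) - a - 1/2)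
  | .Ph n, .G i a => sgl (.J i (a + n)) ((n : ℂ) - a - 1/2)
  | .Q i m, .G j b => sgl (.U (m + b)) (kdel i j)
      + ∑ k : Fin 3, sgl (.J k (m + b)) (eps3 i j k)
  | .G i b, .Q j m => sgl (.U (m + b)) (kdel j i)
      + ∑ k : Fin 3, sgl (.J k (m + b)) (eps3 j i k)
  | .Q i m, .Ph n => sgl (.T i (m + n)) 1
  | .Ph n, .Q i m => sgl (.T i (m + n)) 1
  | .Ph m, .Ph n => sgl (.L (m + n)) 2
  | .Ps a, .G i b => sgl (.T i (a + b + 1)) (-1)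
  | .G i b, .Ps a => sgl (.T i (a + b + 1)) (-1)
  | .Ps a, .Ph n => sgl (.U (a + n)) 1
  | .Ph n, .Ps a => sgl (.U (a + n)) 1
  | _, _ => 0

/-- The bilinear extension of the bracket. -/
def bk (x y : V) : V :=
  x.sum fun a ca => y.sum fun b cb => (ca * cb) • br a b

/-- Parity: `Φ, Q, G, Ψ` are odd. -/
def par : Gen → Bool
  | .Ph _ => true
  | .Q _ _ => true
  | .G _ _ => true
  | .Ps _ => true
  | _ => false

/-- `x` is homogeneous of parity `p`. -/
def homog (p : Bool) (x : V) : Prop := ∀ a ∈ x.support, par a = p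

end TW

namespace UA

/-- The mode `U_0` is annihilated by every bracket. -/
lemma br_U_zero (a : Gen) : br a (.U 0) = 0 := by
  cases a <;> simp [br, sgl]

lemma bk_U_zero (x : V) : bk x (Finsupp.single (.U 0) 1) = 0 := by
  simp [bk, br_U_zero]

end UA

namespace TW

/-- Bracketing with a fixed basis element, as a linear map. -/
def ad (a : Gen) : V →ₗ[ℂ] V := Finsupp.linearCombination ℂ (br a)

lemma bk_single_left (a : Gen) (z : V) : bk (Finsupp.single a 1) z = ad a z := by
  simp [bk, ad, Finsupp.linearCombination_apply]

/-- The basis element `g` with its mode raised by `m`. -/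
def shift (m : ℤ) : Gen → Gen
  | .L n => .L (m + n)
  | .T i n => .T i (m + n)
  | .J i n => .J i (m + n)
  | .U n => .U (m + n)
  | .Ph n => .Ph (m + n)
  | .Q i n => .Q i (m + n)
  | .G i n => .G i (m + n)
  | .Ps n => .Ps (m + n)

lemma shift_injective (m : ℤ) : Function.Injective (shift m) := by
  intro a b h
  cases a <;> cases b <;> simp_all [shift]

/-- The scalar by which `L_m` maps `g` to `shift m g`. -/
def weight (m : ℤ) : Gen → ℂ
  | .L n => (m : ℂ) - n
  | .T _ n => -(n : ℂ)
  | .J _ b => -((b : ℂ) + 1/2)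
  | .U b => -((b : ℂ) + 1/2)
  | .Ph n => (m : ℂ) / 2 - n
  | .Q _ n => -((m : ℂ) / 2 + n)
  | .G _ b => (m : ℂ) / 2 - b - 1/2
  | .Ps b => -((m : ℂ) / 2 + b + 1/2)

lemma br_L (m : ℤ) (g : Gen) : br (.L m) g = Finsupp.single (shift m g) (weight m g) := by
  cases g <;> rfl

lemma ad_L_apply (m : ℤ) (z : V) (g : Gen) :
    ad (.L m) z (shift m g) = weight m g * z g := by
  induction z using Finsupp.induction_linear with
  | zero => simp
  | add x y hx hy => simp [hx, hy, mul_add]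
  | single b c =>
    by_cases h : b = g
    · simp [ad, br_L, h, mul_comm]
    · simp [ad, br_L, h, (shift_injective m).ne h]

lemma ad_J_apply {i k : Fin 3} (hik : i ≠ k) (z : V) :
    ad (.J i 0) z (.J k 0) = ∑ j, -eps3 j i k * z (.T j 0) := by
  induction z using Finsupp.induction_linear with
  | zero => simp
  | add x y hx hy => simp [hx, hy, mul_add, Finset.sum_add_distrib]
  | single b c =>
    cases b with
    | T j n =>
      by_cases hn : n = 0
      · subst hn
        fin_cases j <;> fin_cases k <;> fin_cases i <;>
          simp [ad, br, sgl, Fin.sum_univ_three] <;> ring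
      · simp [ad, br, sgl, hn]
    | _ => simp [ad, br, sgl, hik]

/-- The annihilator of the twisted algebra is trivial. -/
lemma eq_zero_of_ad_eq_zero {z : V} (h : ∀ a, ad a z = 0) : z = 0 := by
  have hw (m : ℤ) (g : Gen) : weight m g = 0 ∨ z g = 0 := by
    simpa [h] using (ad_L_apply m z g).symm
  have hhalf (b : ℤ) : (b : ℂ) + 1 / 2 ≠ 0 := by
    intro hb
    have h2 : ((2 * b + 1 : ℤ) : ℂ) = 0 := by push_cast; linear_combination 2 * hb
    have h3 : 2 * b + 1 = 0 := by exact_mod_cast h2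
    omega
  have hT (j : Fin 3) : z (.T j 0) = 0 := by
    have h01 := ad_J_apply (i := 0) (k := 1) (by decide) z
    have h12 := ad_J_apply (i := 1) (k := 2) (by decide) z
    have h20 := ad_J_apply (i := 2) (k := 0) (by decide) z
    fin_cases j <;> simp_all [eps3]
  ext g
  rw [Finsupp.coe_zero, Pi.zero_apply]
  by_contra hg
  have h0 : weight 0 g = 0 := (hw 0 g).resolve_right hg
  have h1 : weight 1 g = 0 := (hw 1 g).resolve_right hg
  cases g with
  | T j n =>
    have hn : n = 0 := by simpa [weight] using h0
    exact hg (hn ▸ hT j)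
  | J i b => exact hhalf b (neg_eq_zero.mp h0)
  | U b => exact hhalf b (neg_eq_zero.mp h0)
  | L n | Ph n | Q i n | G i n | Ps n =>
    simp only [weight, Int.cast_zero, Int.cast_one] at h0 h1
    have : (1 : ℂ) = 0 := by grind
    exact one_ne_zero this

end TW

/-- The centerless large `N = 4` superconformal algebra `g` and the twisted
superconformal algebra `Alg(A,ω)` are not isomorphic as Lie superalgebras:
there is no parity-preserving ℂ-linear bijection intertwining the brackets. -/
theorem untwisted_not_iso_twisted :
    ¬ ∃ Θ : UA.V ≃ₗ[ℂ] TW.V,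
      (∀ (p : Bool) (x : UA.V), UA.homog p x → TW.homog p (Θ x)) ∧
      (∀ x y : UA.V, Θ (UA.bk x y) = TW.bk (Θ x) (Θ y)) := by
  rintro ⟨Θ, -, hΘ⟩
  have hz : Θ (Finsupp.single (.U 0) 1) = 0 := by
    refine TW.eq_zero_of_ad_eq_zero fun a => ?_
    rw [← TW.bk_single_left, ← Θ.apply_symm_apply (Finsupp.single a 1), ← hΘ,
      UA.bk_U_zero, map_zero]
  simp at hz

end LargeN4

end
end
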